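/- arXiv:2209.08354 — 7 statements merged into one kernel-verified Lean document; each statement's English description precedes it below -/
import Mathlib

section
/- Let q = 2^h be a power of 2 and F a finite field with q elements. Let W₇ = { [[x, y, z], [y, 0, 0], [z, 0, 0]] : x, y, z ∈ F } ⊆ Sym₃(F). Then the point-orbit distribution of W₇ is [1, q+1, q²−1, 0]: W₇ has exactly one rank-1 point, exactly q+1 rank-2 points with zero diagonal, exactly q²−1 rank-2 points with nonzero diagonal, and no rank-3 points. -/
open Matrix

/-- A *point* of a plane `W` of `PG(5,q)` (viewed as a 3-dimensional linear subspace of the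
space of symmetric `3×3` matrices): a 1-dimensional linear subspace `P ≤ W`, all of whose
nonzero matrices satisfy the predicate `pred` (e.g. a rank condition). -/
def IsPointOf (F : Type) [Field F] (W P : Submodule F (Matrix (Fin 3) (Fin 3) F))
    (pred : Matrix (Fin 3) (Fin 3) F → Prop) : Prop :=
  P ≤ W ∧ Module.finrank F ↥P = 1 ∧ ∀ M ∈ P, M ≠ 0 → pred M

/-- The points of `W` satisfying `pred` are counted by any system of representatives. -/
theorem card_isPointOf_eq {F : Type} [Field F]
    (W : Submodule F (Matrix (Fin 3) (Fin 3) F)) (pred : Matrix (Fin 3) (Fin 3) F → Prop)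
    {ι : Type} (f : ι → Matrix (Fin 3) (Fin 3) F)
    (hmem : ∀ i, f i ∈ W) (hne : ∀ i, f i ≠ 0)
    (hpred : ∀ i (c : F), c ≠ 0 → pred (c • f i))
    (hinj : ∀ i j (c : F), c • f i = f j → i = j)
    (hsurj : ∀ M ∈ W, M ≠ 0 → pred M → ∃ i, ∃ c : F, M = c • f i) :
    Nat.card {P | IsPointOf F W P pred} = Nat.card ι := by
  symm
  refine Nat.card_eq_of_bijective
    (fun i => ⟨Submodule.span F {f i}, ?_, finrank_span_singleton (hne i), ?_⟩) ⟨?_, ?_⟩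
  · simpa using hmem i
  · intro M hM hM0
    obtain ⟨c, rfl⟩ := Submodule.mem_span_singleton.1 hM
    exact hpred i c fun hc => hM0 (by simp [hc])
  · intro i j hij
    have hspan : Submodule.span F {f i} = Submodule.span F {f j} := congrArg Subtype.val hij
    obtain ⟨c, hc⟩ := Submodule.mem_span_singleton.1
      (hspan ▸ Submodule.mem_span_singleton_self (f j))
    exact hinj i j c hc
  · rintro ⟨P, hPW, hP1, hP⟩
    obtain ⟨⟨v, hv⟩, hv0, hspan⟩ := finrank_eq_one_iff'.1 hP1
    have hv0' : v ≠ 0 := fun h => hv0 (Subtype.ext h)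
    obtain ⟨i, c, hvc⟩ := hsurj v (hPW hv) hv0' (hP v hv hv0')
    have hc : c ≠ 0 := fun hc => hv0' (by simp [hvc, hc])
    refine ⟨i, Subtype.ext ?_⟩
    apply le_antisymm
    · rw [Submodule.span_singleton_le_iff_mem]
      have : f i = c⁻¹ • v := by rw [hvc, smul_smul, inv_mul_cancel₀ hc, one_smul]
      rw [this]
      exact P.smul_mem _ hv
    · intro w hw
      obtain ⟨d, hd⟩ := hspan ⟨w, hw⟩
      have hd' : d • v = w := congrArg Subtype.val hd
      rw [← hd', hvc, smul_smul]
      exact Submodule.smul_mem _ _ (Submodule.mem_span_singleton_self _)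

/-- The general element of the plane. -/
def sigma7Matrix {F : Type} [Field F] (x y z : F) : Matrix (Fin 3) (Fin 3) F :=
  !![x, y, z; y, 0, 0; z, 0, 0]

theorem sigma7Matrix_inj {F : Type} [Field F] {x y z x' y' z' : F} :
    sigma7Matrix x y z = sigma7Matrix x' y' z' ↔ x = x' ∧ y = y' ∧ z = z' := by
  constructor
  · intro h
    exact ⟨congrFun (congrFun h 0) 0, congrFun (congrFun h 0) 1, congrFun (congrFun h 0) 2⟩
  · rintro ⟨rfl, rfl, rfl⟩
    rfl

theorem smul_sigma7Matrix {F : Type} [Field F] (c x y z : F) :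
    c • sigma7Matrix x y z = sigma7Matrix (c * x) (c * y) (c * z) := by
  simp [sigma7Matrix]

theorem sigma7Matrix_zero {F : Type} [Field F] :
    sigma7Matrix (0 : F) 0 0 = 0 := by
  ext i j
  fin_cases i <;> fin_cases j <;> rfl

theorem sigma7Matrix_eq_zero {F : Type} [Field F] {x y z : F} :
    sigma7Matrix x y z = 0 ↔ x = 0 ∧ y = 0 ∧ z = 0 := by
  rw [← sigma7Matrix_zero, sigma7Matrix_inj]

theorem rank_sigma7Matrix_of_ne {F : Type} [Field F] {x y z : F} (h : ¬(y = 0 ∧ z = 0)) :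
    (sigma7Matrix x y z).rank = 2 := by
  apply le_antisymm
  · have hmul : sigma7Matrix x y z =
        (!![1, 0; 0, y; 0, z] : Matrix (Fin 3) (Fin 2) F) * !![x, y, z; 1, 0, 0] := by
      ext i j
      fin_cases i <;> fin_cases j <;> simp [sigma7Matrix]
    rw [hmul]
    exact (rank_mul_le_left _ _).trans (rank_le_width _)
  · have key : ∀ (k : Fin 3) (t : F), t ≠ 0 →
        (sigma7Matrix x y z).submatrix ![0, k] ![0, k] = !![x, t; t, 0] →
        2 ≤ (sigma7Matrix x y z).rank := by
      intro k t ht hsub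
      have hrank : (!![x, t; t, 0] : Matrix (Fin 2) (Fin 2) F).rank = 2 := by
        rw [rank_of_isUnit _ ((isUnit_iff_isUnit_det _).2 (by simp [det_fin_two, ht]))]
        simp
      rw [← hrank, ← hsub]
      exact rank_submatrix_le _ _ _
    by_cases hy : y = 0
    · exact key 2 z (fun hz => h ⟨hy, hz⟩) (by
        ext i j
        fin_cases i <;> fin_cases j <;> rfl)
    · exact key 1 y hy (by
        ext i j
        fin_cases i <;> fin_cases j <;> rfl)

theorem rank_sigma7Matrix_of_eq {F : Type} [Field F] {x : F} (hx : x ≠ 0) :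
    (sigma7Matrix x 0 0).rank = 1 := by
  have hvec : sigma7Matrix x 0 0 = vecMulVec ![1, 0, 0] ![x, 0, 0] := by
    ext i j
    fin_cases i <;> fin_cases j <;> simp [sigma7Matrix, vecMulVec_apply]
  apply le_antisymm
  · rw [hvec]
    exact rank_vecMulVec_le _ _
  · have hrank : ((sigma7Matrix x 0 0).submatrix ![(0 : Fin 3)] ![(0 : Fin 3)]).rank = 1 := by
      rw [rank_of_isUnit _ ((isUnit_iff_isUnit_det _).2 (by
        rw [det_fin_one]
        simpa [sigma7Matrix] using hx))]
      simp
    rw [← hrank]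
    exact rank_submatrix_le _ _ _

theorem sigma7Matrix_diag_eq_zero {F : Type} [Field F] {x y z : F} :
    (∀ i, sigma7Matrix x y z i i = 0) ↔ x = 0 := by
  simp [Fin.forall_fin_succ, sigma7Matrix]

theorem rank_sigma7Matrix_eq_two {F : Type} [Field F] {x y z : F} :
    (sigma7Matrix x y z).rank = 2 ↔ ¬(y = 0 ∧ z = 0) := by
  refine ⟨?_, rank_sigma7Matrix_of_ne⟩
  rintro h ⟨rfl, rfl⟩
  by_cases hx : x = 0
  · simp [hx, sigma7Matrix_zero] at h
  · simp [rank_sigma7Matrix_of_eq hx] at h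

theorem rank_sigma7Matrix_eq_one {F : Type} [Field F] {x y z : F} :
    (sigma7Matrix x y z).rank = 1 ↔ x ≠ 0 ∧ y = 0 ∧ z = 0 := by
  constructor
  · intro h
    by_cases hyz : y = 0 ∧ z = 0
    · refine ⟨?_, hyz⟩
      rintro rfl
      simp [hyz.1, hyz.2, sigma7Matrix_zero] at h
    · simp [rank_sigma7Matrix_of_ne hyz] at h
  · rintro ⟨hx, rfl, rfl⟩
    exact rank_sigma7Matrix_of_eq hx

theorem rank_sigma7Matrix_ne_three {F : Type} [Field F] {x y z : F} :
    (sigma7Matrix x y z).rank ≠ 3 := by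
  intro h
  by_cases hyz : y = 0 ∧ z = 0
  · by_cases hx : x = 0
    · simp [hx, hyz.1, hyz.2, sigma7Matrix_zero] at h
    · rw [hyz.1, hyz.2, rank_sigma7Matrix_of_eq hx] at h
      simp at h
  · simp [rank_sigma7Matrix_of_ne hyz] at h

theorem sigma7_point_orbit_distribution (h : ℕ) (hh : 0 < h)
    (F : Type) [Field F] [Fintype F] (hF : Fintype.card F = 2 ^ h)
    (W : Submodule F (Matrix (Fin 3) (Fin 3) F))
    (hW : (W : Set (Matrix (Fin 3) (Fin 3) F)) =
      {M | ∃ x y z : F, M = !![x, y, z; y, 0, 0; z, 0, 0]}) :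
    Nat.card {P | IsPointOf F W P (fun M => M.rank = 1)} = 1 ∧
    Nat.card {P | IsPointOf F W P (fun M => M.rank = 2 ∧ ∀ i, M i i = 0)} = 2 ^ h + 1 ∧
    Nat.card {P | IsPointOf F W P (fun M => M.rank = 2 ∧ ∃ i, M i i ≠ 0)} = (2 ^ h) ^ 2 - 1 ∧
    Nat.card {P | IsPointOf F W P (fun M => M.rank = 3)} = 0 := by
  classical
  have hmem : ∀ M, M ∈ W ↔ ∃ x y z : F, M = sigma7Matrix x y z := fun M => Set.ext_iff.1 hW M
  have hmem' : ∀ x y z, sigma7Matrix x y z ∈ W := fun x y z => (hmem _).2 ⟨x, y, z, rfl⟩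
  refine ⟨?_, ?_, ?_, ?_⟩
  · rw [card_isPointOf_eq W _ (fun _ : Unit => sigma7Matrix 1 0 0)]
    · simp
    · exact fun _ => hmem' _ _ _
    · simp [sigma7Matrix_eq_zero]
    · intro _ c hc
      simp [smul_sigma7Matrix, rank_sigma7Matrix_eq_one, hc]
    · intros
      rfl
    · intro M hM _ hr
      obtain ⟨x, y, z, rfl⟩ := (hmem M).1 hM
      obtain ⟨_, rfl, rfl⟩ := rank_sigma7Matrix_eq_one.1 hr
      exact ⟨(), x, by simp [smul_sigma7Matrix]⟩
  · rw [card_isPointOf_eq W _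
      (fun o : Option F => o.elim (sigma7Matrix 0 0 1) (fun t => sigma7Matrix 0 1 t))]
    · simp [hF]
    · rintro (_ | t) <;> exact hmem' _ _ _
    · rintro (_ | t) <;> simp [sigma7Matrix_eq_zero]
    · rintro (_ | t) c hc <;>
        simp [smul_sigma7Matrix, rank_sigma7Matrix_eq_two, sigma7Matrix_diag_eq_zero, hc]
    · rintro (_ | t) (_ | s) c hc
      · rfl
      · simp [smul_sigma7Matrix, sigma7Matrix_inj] at hc
      · simp only [Option.elim, smul_sigma7Matrix, sigma7Matrix_inj] at hc
        obtain ⟨-, h1, h2⟩ := hc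
        simp_all
      · simp only [Option.elim, smul_sigma7Matrix, sigma7Matrix_inj] at hc
        obtain ⟨-, h1, h2⟩ := hc
        simp_all
    · rintro M hM _ ⟨hr, hd⟩
      obtain ⟨x, y, z, rfl⟩ := (hmem M).1 hM
      obtain rfl := sigma7Matrix_diag_eq_zero.1 hd
      by_cases hy : y = 0
      · exact ⟨none, z, by simp [smul_sigma7Matrix, hy]⟩
      · exact ⟨some (z / y), y, by simp [smul_sigma7Matrix, mul_div_cancel₀ _ hy]⟩
  · rw [card_isPointOf_eq W _
      (fun p : {p : F × F // p ≠ 0} => sigma7Matrix 1 p.1.1 p.1.2)]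
    · rw [Nat.card_eq_fintype_card, Fintype.card_subtype_compl]
      simp [hF, sq]
    · exact fun _ => hmem' _ _ _
    · simp [sigma7Matrix_eq_zero]
    · rintro ⟨⟨y, z⟩, hp⟩ c hc
      simp only [← not_forall]
      simp_all [smul_sigma7Matrix, rank_sigma7Matrix_eq_two, sigma7Matrix_diag_eq_zero]
    · rintro ⟨⟨y, z⟩, hp⟩ ⟨⟨y', z'⟩, hp'⟩ c hc
      simp only [smul_sigma7Matrix, sigma7Matrix_inj] at hc
      obtain ⟨h1, h2, h3⟩ := hc
      simp_all
    · rintro M hM _ ⟨hr, hd⟩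
      obtain ⟨x, y, z, rfl⟩ := (hmem M).1 hM
      have hx : x ≠ 0 := fun hx => by
        obtain ⟨i, hi⟩ := hd
        exact hi (sigma7Matrix_diag_eq_zero.2 hx i)
      rw [rank_sigma7Matrix_eq_two] at hr
      refine ⟨⟨(y / x, z / x), ?_⟩, x, ?_⟩
      · simpa [hx] using hr
      · simp [smul_sigma7Matrix, mul_div_cancel₀ _ hx]
  · rw [card_isPointOf_eq W _ (fun e : Empty => e.elim)]
    · simp
    · exact fun e => e.elim
    · exact fun e => e.elim
    · exact fun e => e.elim
    · exact fun e => e.elim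
    · intro M hM _ hr
      obtain ⟨x, y, z, rfl⟩ := (hmem M).1 hM
      exact absurd hr rank_sigma7Matrix_ne_three
end

section
/- Let q = 2^h be a power of 2 and F a finite field with q elements. Let W₉ = { [[x, y, 0], [y, z, z], [0, z, 0]] : x, y, z ∈ F } ⊆ Sym₃(F). Then the point-orbit distribution of W₉ is [1, 1, 2q−1, q²−q]: W₉ has exactly one rank-1 point, exactly one rank-2 point with zero diagonal, exactly 2q−1 rank-2 points with nonzero diagonal, and exactly q²−q rank-3 points. -/
open Matrix

/-- The symmetric matrices parametrizing the plane `W₉`. -/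
def sigma9Matrix {F : Type} [Field F] (x y z : F) : Matrix (Fin 3) (Fin 3) F :=
  !![x, y, 0; y, z, z; 0, z, 0]

section Rank

variable {F : Type} [Field F]

theorem Matrix.le_rank_of_det_submatrix_ne_zero {m n : Type*} [Fintype m] [Fintype n] {k : ℕ}
    (A : Matrix m n F) (r : Fin k → m) (c : Fin k → n) (h : (A.submatrix r c).det ≠ 0) :
    k ≤ A.rank := by
  have := rank_of_det_ne_zero h
  rw [Fintype.card_fin] at this
  exact this ▸ rank_submatrix_le A r c

theorem Matrix.rank_lt_of_det_eq_zero {n : ℕ} (A : Matrix (Fin n) (Fin n) F) (h : A.det = 0) :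
    A.rank < n := by
  obtain ⟨v, hv, hAv⟩ := exists_mulVec_eq_zero_iff.mpr h
  have hker : LinearMap.ker A.mulVecLin ≠ ⊥ := fun hbot =>
    hv ((Submodule.eq_bot_iff _).mp hbot v (by simpa using hAv))
  have hpos : 0 < Module.finrank F (LinearMap.ker A.mulVecLin) :=
    Nat.pos_of_ne_zero fun h0 => hker (Submodule.finrank_eq_zero.mp h0)
  have hsum := A.mulVecLin.finrank_range_add_finrank_ker
  rw [Module.finrank_fin_fun] at hsum
  rw [Matrix.rank]
  omega

theorem smul_sigma9Matrix (c x y z : F) :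
    c • sigma9Matrix x y z = sigma9Matrix (c * x) (c * y) (c * z) := by
  simp [sigma9Matrix]

theorem sigma9Matrix_inj {x y z x' y' z' : F} :
    sigma9Matrix x y z = sigma9Matrix x' y' z' ↔ x = x' ∧ y = y' ∧ z = z' := by
  refine ⟨fun h => ⟨?_, ?_, ?_⟩, by rintro ⟨rfl, rfl, rfl⟩; rfl⟩
  · simpa [sigma9Matrix] using congrFun₂ h 0 0
  · simpa [sigma9Matrix] using congrFun₂ h 0 1
  · simpa [sigma9Matrix] using congrFun₂ h 1 1

theorem sigma9Matrix_eq_zero_iff {x y z : F} :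
    sigma9Matrix x y z = 0 ↔ x = 0 ∧ y = 0 ∧ z = 0 := by
  rw [← sigma9Matrix_inj, show sigma9Matrix (0 : F) 0 0 = 0 by
    ext i j; fin_cases i <;> fin_cases j <;> rfl]

theorem det_sigma9Matrix (x y z : F) : (sigma9Matrix x y z).det = -(x * z ^ 2) := by
  simp [sigma9Matrix, det_fin_three]
  ring

theorem sigma9Matrix_diag_eq_zero_iff {x y z : F} :
    (∀ i, sigma9Matrix x y z i i = 0) ↔ x = 0 ∧ z = 0 := by
  simp [sigma9Matrix, Fin.forall_fin_succ]

theorem sigma9Matrix_exists_diag_ne_zero_iff {x y z : F} :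
    (∃ i, sigma9Matrix x y z i i ≠ 0) ↔ ¬(x = 0 ∧ z = 0) := by
  rw [← sigma9Matrix_diag_eq_zero_iff (y := y), not_forall]

open Classical in
theorem rank_sigma9Matrix (x y z : F) :
    (sigma9Matrix x y z).rank =
      if z = 0 then if y = 0 then if x = 0 then 0 else 1 else 2
      else if x = 0 then 2 else 3 := by
  split_ifs with hz hy hx hx
  · rw [sigma9Matrix_eq_zero_iff.mpr ⟨hx, hy, hz⟩, rank_zero]
  · apply le_antisymm
    · have : sigma9Matrix x y z = vecMulVec ![x, 0, 0] ![1, 0, 0] := by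
        ext i j
        fin_cases i <;> fin_cases j <;> simp [sigma9Matrix, vecMulVec, hy, hz]
      rw [this]
      exact rank_vecMulVec_le _ _
    · apply le_rank_of_det_submatrix_ne_zero _ ![0] ![0]
      rw [det_fin_one]
      simpa [sigma9Matrix] using hx
  · apply le_antisymm
    · exact Nat.le_of_lt_succ (rank_lt_of_det_eq_zero _ (by simp [det_sigma9Matrix, hz]))
    · apply le_rank_of_det_submatrix_ne_zero _ ![0, 1] ![0, 1]
      rw [det_fin_two]
      simpa [sigma9Matrix, hz] using hy
  · apply le_antisymm
    · exact Nat.le_of_lt_succ (rank_lt_of_det_eq_zero _ (by simp [det_sigma9Matrix, hx]))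
    · apply le_rank_of_det_submatrix_ne_zero _ ![1, 2] ![1, 2]
      rw [det_fin_two]
      simpa [sigma9Matrix] using hz
  · rw [rank_of_det_ne_zero (by simp [det_sigma9Matrix, hx, hz]), Fintype.card_fin]

end Rank

/-- A system of representatives `g` for the points of `W` satisfying `pred` counts these points. -/
theorem card_isPointOf_eq_card {F : Type} [Field F]
    {W : Submodule F (Matrix (Fin 3) (Fin 3) F)} {pred : Matrix (Fin 3) (Fin 3) F → Prop}
    {ι : Type} (g : ι → Matrix (Fin 3) (Fin 3) F) (hgW : ∀ i, g i ∈ W) (hg0 : ∀ i, g i ≠ 0)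
    (hpred : ∀ i (c : F), c ≠ 0 → pred (c • g i))
    (hsurj : ∀ M ∈ W, M ≠ 0 → pred M → ∃ i, ∃ c : F, M = c • g i)
    (hinj : ∀ i j (c : F), g i = c • g j → i = j) :
    Nat.card {P | IsPointOf F W P pred} = Nat.card ι := by
  symm
  refine Nat.card_congr (Equiv.ofBijective
    (fun i => ⟨Submodule.span F {g i}, ?_, finrank_span_singleton (hg0 i), ?_⟩) ⟨?_, ?_⟩)
  · simpa [Submodule.span_singleton_le_iff_mem] using hgW i
  · intro M hM hM0
    obtain ⟨c, rfl⟩ := Submodule.mem_span_singleton.mp hM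
    exact hpred i c fun hc => hM0 (by simp [hc])
  · intro i j hij
    have hmem : g i ∈ Submodule.span F {g j} := by
      rw [← show Submodule.span F {g i} = Submodule.span F {g j} from congrArg Subtype.val hij]
      exact Submodule.mem_span_singleton_self _
    obtain ⟨c, hc⟩ := Submodule.mem_span_singleton.mp hmem
    exact hinj i j c hc.symm
  · rintro ⟨P, hPW, hP1, hP⟩
    obtain ⟨⟨v, hvP⟩, hv0, -⟩ := finrank_eq_one_iff'.mp hP1
    have hv0' : v ≠ 0 := fun h => hv0 (Subtype.ext h)
    obtain ⟨i, c, hc⟩ := hsurj v (hPW hvP) hv0' (hP v hvP hv0')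
    have hc0 : c ≠ 0 := by
      rintro rfl
      exact hv0' (by simpa using hc)
    have hle : Submodule.span F {g i} ≤ P := by
      rw [Submodule.span_singleton_le_iff_mem]
      have := P.smul_mem c⁻¹ hvP
      rwa [hc, inv_smul_smul₀ hc0] at this
    have : FiniteDimensional F P := Module.finite_of_finrank_pos (by omega)
    exact ⟨i, Subtype.ext (Submodule.eq_of_le_of_finrank_eq hle
      (by rw [finrank_span_singleton (hg0 i), hP1]))⟩

theorem sigma9_point_orbit_distribution (h : ℕ) (hh : 0 < h)
    (F : Type) [Field F] [Fintype F] (hF : Fintype.card F = 2 ^ h)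
    (W : Submodule F (Matrix (Fin 3) (Fin 3) F))
    (hW : (W : Set (Matrix (Fin 3) (Fin 3) F)) =
      {M | ∃ x y z : F, M = !![x, y, 0; y, z, z; 0, z, 0]}) :
    Nat.card {P | IsPointOf F W P (fun M => M.rank = 1)} = 1 ∧
    Nat.card {P | IsPointOf F W P (fun M => M.rank = 2 ∧ ∀ i, M i i = 0)} = 1 ∧
    Nat.card {P | IsPointOf F W P (fun M => M.rank = 2 ∧ ∃ i, M i i ≠ 0)} = 2 * 2 ^ h - 1 ∧
    Nat.card {P | IsPointOf F W P (fun M => M.rank = 3)} = (2 ^ h) ^ 2 - 2 ^ h := by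
  classical
  have mem_W : ∀ M, M ∈ W ↔ ∃ x y z : F, M = sigma9Matrix x y z := fun M => by
    rw [← SetLike.mem_coe, hW]
    rfl
  have sigma9_mem : ∀ x y z : F, sigma9Matrix x y z ∈ W := fun x y z =>
    (mem_W _).mpr ⟨x, y, z, rfl⟩
  have card_units : Nat.card Fˣ = 2 ^ h - 1 := by
    rw [Nat.card_eq_fintype_card, Fintype.card_units, hF]
  have card_F : Nat.card F = 2 ^ h := by rw [Nat.card_eq_fintype_card, hF]
  have hpos : 0 < 2 ^ h := by positivity
  refine ⟨?_, ?_, ?_, ?_⟩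
  · rw [card_isPointOf_eq_card (fun _ : Unit => sigma9Matrix (1 : F) 0 0), Nat.card_unique]
    · exact fun _ => sigma9_mem _ _ _
    · simp [sigma9Matrix_eq_zero_iff]
    · intro _ c hc
      simp [smul_sigma9Matrix, rank_sigma9Matrix, hc]
    · intro M hM _ hr
      obtain ⟨x, y, z, rfl⟩ := (mem_W M).mp hM
      rw [rank_sigma9Matrix] at hr
      refine ⟨(), x, ?_⟩
      rw [smul_sigma9Matrix, sigma9Matrix_inj]
      split_ifs at hr <;> simp_all
    · exact fun _ _ _ _ => rfl
  · rw [card_isPointOf_eq_card (fun _ : Unit => sigma9Matrix (0 : F) 1 0), Nat.card_unique]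
    · exact fun _ => sigma9_mem _ _ _
    · simp [sigma9Matrix_eq_zero_iff]
    · intro _ c hc
      simp [smul_sigma9Matrix, rank_sigma9Matrix, sigma9Matrix_diag_eq_zero_iff, hc]
    · rintro M hM _ ⟨-, hd⟩
      obtain ⟨x, y, z, rfl⟩ := (mem_W M).mp hM
      rw [sigma9Matrix_diag_eq_zero_iff] at hd
      refine ⟨(), y, ?_⟩
      simp [smul_sigma9Matrix, hd]
    · exact fun _ _ _ _ => rfl
  · rw [card_isPointOf_eq_card (Sum.elim (fun x : Fˣ => sigma9Matrix (x : F) 1 0)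
      (fun y : F => sigma9Matrix 0 y 1)), Nat.card_sum, card_units, card_F]
    · omega
    · rintro (x | y) <;> exact sigma9_mem _ _ _
    · rintro (x | y) <;> simp [sigma9Matrix_eq_zero_iff]
    · rintro (x | y) c hc <;>
        simp only [Sum.elim_inl, Sum.elim_inr, smul_sigma9Matrix, rank_sigma9Matrix,
          sigma9Matrix_exists_diag_ne_zero_iff] <;>
        simp [hc]
    · rintro M hM _ ⟨hr, hd⟩
      obtain ⟨x, y, z, rfl⟩ := (mem_W M).mp hM
      rw [sigma9Matrix_exists_diag_ne_zero_iff] at hd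
      rw [rank_sigma9Matrix] at hr
      by_cases hz : z = 0
      · have hx : x ≠ 0 := fun hx => hd ⟨hx, hz⟩
        have hy : y ≠ 0 := by
          rintro rfl
          simp [hz, hx] at hr
        refine ⟨Sum.inl (Units.mk0 (x / y) (div_ne_zero hx hy)), y, ?_⟩
        simp [smul_sigma9Matrix, hz, mul_div_cancel₀ _ hy]
      · have hx : x = 0 := by
          by_contra hx
          simp [hz, hx] at hr
        refine ⟨Sum.inr (y / z), z, ?_⟩
        simp [smul_sigma9Matrix, hx, mul_div_cancel₀ _ hz]
    · rintro (x | y) (x' | y') c hc <;>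
        simp only [Sum.elim_inl, Sum.elim_inr, smul_sigma9Matrix, sigma9Matrix_inj] at hc <;>
        obtain ⟨h1, h2, h3⟩ := hc
      · simp only [mul_one] at h2
        exact congrArg _ (Units.ext (by simpa [← h2] using h1))
      · simp at h1
      · simp at h3
      · simp only [mul_one] at h3
        exact congrArg _ (by simpa [← h3] using h2)
  · rw [card_isPointOf_eq_card (fun p : Fˣ × F => sigma9Matrix (p.1 : F) p.2 1), Nat.card_prod,
      card_units, card_F, Nat.sub_mul, one_mul, sq]
    · exact fun _ => sigma9_mem _ _ _
    · simp [sigma9Matrix_eq_zero_iff]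
    · intro p c hc
      simp [smul_sigma9Matrix, rank_sigma9Matrix, hc]
    · intro M hM _ hr
      obtain ⟨x, y, z, rfl⟩ := (mem_W M).mp hM
      rw [rank_sigma9Matrix] at hr
      have hz : z ≠ 0 := by
        intro hz
        split_ifs at hr <;> simp_all
      have hx : x ≠ 0 := by
        intro hx
        simp [hz, hx] at hr
      refine ⟨(Units.mk0 (x / z) (div_ne_zero hx hz), y / z), z, ?_⟩
      simp [smul_sigma9Matrix, mul_div_cancel₀ _ hz]
    · rintro ⟨x, y⟩ ⟨x', y'⟩ c hc
      simp only [smul_sigma9Matrix, sigma9Matrix_inj, mul_one] at hc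
      obtain ⟨h1, h2, h3⟩ := hc
      exact Prod.ext (Units.ext (by simpa [← h3] using h1)) (by simpa [← h3] using h2)
end

section
/- Let q = 2^h be a power of 2 and F a finite field with q elements. Let W₁₁ = { [[x, y, 0], [y, z, z], [0, z, x + z]] : x, y, z ∈ F } ⊆ Sym₃(F). Then the point-orbit distribution of W₁₁ is [1, 1, q−1, q²]: W₁₁ has exactly one rank-1 point, exactly one rank-2 point with zero diagonal, exactly q−1 rank-2 points with nonzero diagonal, and exactly q² rank-3 points. -/
open Matrix

/-- The symmetric matrix with coordinates `(x, y, z)` in the plane `Σ₁₁`. -/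
def sigma11Matrix {F : Type} [Field F] (x y z : F) : Matrix (Fin 3) (Fin 3) F :=
  !![x, y, 0; y, z, z; 0, z, x + z]

section Sigma11

variable {F : Type} [Field F]

theorem smul_sigma11Matrix (c x y z : F) :
    c • sigma11Matrix x y z = sigma11Matrix (c * x) (c * y) (c * z) := by
  ext i j
  fin_cases i <;> fin_cases j <;> simp [sigma11Matrix, mul_add]

theorem sigma11Matrix_inj {x y z x' y' z' : F} :
    sigma11Matrix x y z = sigma11Matrix x' y' z' ↔ x = x' ∧ y = y' ∧ z = z' := by
  constructor
  · intro h
    have h00 := congrFun (congrFun h 0) 0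
    have h01 := congrFun (congrFun h 0) 1
    have h11 := congrFun (congrFun h 1) 1
    exact ⟨by simpa [sigma11Matrix] using h00, by simpa [sigma11Matrix] using h01,
      by simpa [sigma11Matrix] using h11⟩
  · rintro ⟨rfl, rfl, rfl⟩
    rfl

theorem sigma11Matrix_eq_zero {x y z : F} :
    sigma11Matrix x y z = 0 ↔ x = 0 ∧ y = 0 ∧ z = 0 := by
  have h : sigma11Matrix (0 : F) 0 0 = 0 := by
    simpa using (smul_sigma11Matrix (0 : F) 0 0 0).symm
  rw [← h, sigma11Matrix_inj]

theorem det_sigma11Matrix (h2 : (2 : F) = 0) (x y z : F) :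
    (sigma11Matrix x y z).det = z * (x + y) ^ 2 - y ^ 2 * x := by
  rw [sigma11Matrix, Matrix.det_fin_three]
  simp
  linear_combination (-z * y ^ 2 - x * y * z) * h2

theorem Matrix.rank_eq_card_iff_det_ne_zero {n : Type} [Fintype n] [DecidableEq n]
    (A : Matrix n n F) : A.rank = Fintype.card n ↔ A.det ≠ 0 := by
  refine ⟨fun h => ?_, A.rank_of_det_ne_zero⟩
  have hli : LinearIndependent F A.row := by
    rw [linearIndependent_iff_card_eq_finrank_span, Set.finrank, ← A.rank_eq_finrank_span_row, h]
  exact ((A.isUnit_iff_isUnit_det).1 (linearIndependent_rows_iff_isUnit.1 hli)).ne_zero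

theorem Matrix.two_le_rank_of_minor_ne_zero {m n : Type} [Fintype m] [Fintype n]
    (A : Matrix m n F) (i i' : m) (j j' : n) (h : A i j * A i' j' - A i j' * A i' j ≠ 0) :
    2 ≤ A.rank := by
  have hr := A.rank_submatrix_le ![i, i'] ![j, j']
  rwa [Matrix.rank_of_det_ne_zero (by rw [Matrix.det_fin_two]; simpa using h), Fintype.card_fin] at hr

theorem rank_sigma11Matrix_eq_three (h2 : (2 : F) = 0) (x y z : F) :
    (sigma11Matrix x y z).rank = 3 ↔ z * (x + y) ^ 2 ≠ y ^ 2 * x := by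
  rw [← sub_ne_zero, ← det_sigma11Matrix h2, ← Matrix.rank_eq_card_iff_det_ne_zero,
    Fintype.card_fin]

theorem two_le_rank_sigma11Matrix {x y : F} (z : F) (h : x ≠ 0 ∨ y ≠ 0) :
    2 ≤ (sigma11Matrix x y z).rank := by
  by_cases hx : x = 0
  · refine Matrix.two_le_rank_of_minor_ne_zero _ 0 1 0 1 ?_
    simpa [sigma11Matrix, hx] using h
  by_cases hz : z = 0
  · refine Matrix.two_le_rank_of_minor_ne_zero _ 0 2 0 2 ?_
    simp [sigma11Matrix, hx, hz]
  · refine Matrix.two_le_rank_of_minor_ne_zero _ 0 1 0 2 ?_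
    simp [sigma11Matrix, hx, hz]

theorem rank_sigma11Matrix_le_one (z : F) : (sigma11Matrix 0 0 z).rank ≤ 1 := by
  have h : sigma11Matrix 0 0 z = vecMulVec ![0, 1, 1] ![0, z, z] := by
    ext i j
    fin_cases i <;> fin_cases j <;> simp [sigma11Matrix, vecMulVec_apply]
  exact h ▸ rank_vecMulVec_le _ _

theorem rank_sigma11Matrix_eq_one {x y z : F} (h0 : sigma11Matrix x y z ≠ 0) :
    (sigma11Matrix x y z).rank = 1 ↔ x = 0 ∧ y = 0 := by
  constructor
  · intro h
    by_contra hxy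
    have := two_le_rank_sigma11Matrix (x := x) (y := y) z (by tauto)
    omega
  · rintro ⟨rfl, rfl⟩
    have hz : z ≠ 0 := by simpa [sigma11Matrix_eq_zero] using h0
    have hr := (sigma11Matrix 0 0 z).rank_submatrix_le ![(1 : Fin 3)] ![(1 : Fin 3)]
    rw [Matrix.rank_of_det_ne_zero (by rw [Matrix.det_fin_one]; simpa [sigma11Matrix] using hz), Fintype.card_fin] at hr
    exact le_antisymm (rank_sigma11Matrix_le_one z) hr

theorem rank_sigma11Matrix_eq_two (h2 : (2 : F) = 0) (x y z : F) :
    (sigma11Matrix x y z).rank = 2 ↔ (x ≠ 0 ∨ y ≠ 0) ∧ z * (x + y) ^ 2 = y ^ 2 * x := by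
  constructor
  · intro h
    refine ⟨?_, ?_⟩
    · by_contra! hxy
      obtain ⟨rfl, rfl⟩ := hxy
      have := rank_sigma11Matrix_le_one z
      omega
    · by_contra hd
      have := (rank_sigma11Matrix_eq_three h2 x y z).2 hd
      omega
  · rintro ⟨hxy, hd⟩
    have h3 := (rank_sigma11Matrix_eq_three h2 x y z).not.2 (not_not.2 hd)
    have hle := two_le_rank_sigma11Matrix z hxy
    have hw := (sigma11Matrix x y z).rank_le_width
    omega

theorem sigma11Matrix_diag_eq_zero {x y z : F} :
    (∀ i, sigma11Matrix x y z i i = 0) ↔ x = 0 ∧ z = 0 := by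
  simp only [Fin.forall_fin_succ, sigma11Matrix]
  simp
  grind

theorem rank_two_diag_zero_iff (h2 : (2 : F) = 0) {x y z : F} (h0 : sigma11Matrix x y z ≠ 0) :
    ((sigma11Matrix x y z).rank = 2 ∧ ∀ i, sigma11Matrix x y z i i = 0) ↔ x = 0 ∧ z = 0 := by
  rw [rank_sigma11Matrix_eq_two h2, sigma11Matrix_diag_eq_zero]
  rw [ne_eq, sigma11Matrix_eq_zero] at h0
  constructor
  · exact And.right
  · rintro ⟨rfl, rfl⟩
    simpa using h0

theorem rank_two_diag_ne_zero_iff (h2 : (2 : F) = 0) {x y z : F} :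
    ((sigma11Matrix x y z).rank = 2 ∧ ∃ i, sigma11Matrix x y z i i ≠ 0) ↔
      x ≠ 0 ∧ z * (x + y) ^ 2 = y ^ 2 * x := by
  rw [rank_sigma11Matrix_eq_two h2, ← not_forall, sigma11Matrix_diag_eq_zero]
  constructor
  · rintro ⟨⟨hxy, hd⟩, hxz⟩
    refine ⟨?_, hd⟩
    rintro rfl
    simp_all
  · rintro ⟨hx, hd⟩
    exact ⟨⟨Or.inl hx, hd⟩, fun h => hx h.1⟩

/-- If the family `f` of nonzero matrices contains exactly one representative of every point of
`W` satisfying `pred`, then it counts these points. -/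
theorem natCard_isPointOf {α : Type} {W : Submodule F (Matrix (Fin 3) (Fin 3) F)}
    {pred : Matrix (Fin 3) (Fin 3) F → Prop} (f : α → Matrix (Fin 3) (Fin 3) F)
    (hfW : ∀ a, f a ∈ W) (hf0 : ∀ a, f a ≠ 0) (hpred : ∀ a, ∀ c : F, c ≠ 0 → pred (c • f a))
    (hinj : ∀ a b, ∀ c : F, f a = c • f b → a = b)
    (hsurj : ∀ M ∈ W, M ≠ 0 → pred M → ∃ a, ∃ c : F, M = c • f a) :
    Nat.card {P | IsPointOf F W P pred} = Nat.card α := by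
  have hpt (a : α) : IsPointOf F W (F ∙ f a) pred := by
    refine ⟨by simpa using hfW a, finrank_span_singleton (hf0 a), fun M hM hM0 => ?_⟩
    obtain ⟨c, rfl⟩ := Submodule.mem_span_singleton.1 hM
    exact hpred a c fun hc => hM0 (by simp [hc])
  symm
  refine Nat.card_eq_of_bijective (fun a => ⟨F ∙ f a, hpt a⟩) ⟨fun a b hab => ?_, ?_⟩
  · have hspan : F ∙ f a = F ∙ f b := congrArg Subtype.val hab
    have hmem : f a ∈ F ∙ f b := hspan ▸ Submodule.mem_span_singleton_self (f a)
    obtain ⟨c, hc⟩ := Submodule.mem_span_singleton.1 hmem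
    exact hinj a b c hc.symm
  · rintro ⟨P, hPW, hP1, hP⟩
    obtain ⟨⟨M, hMP⟩, hM0, -⟩ := finrank_eq_one_iff'.1 hP1
    have hM0' : M ≠ 0 := fun h => hM0 (Subtype.ext h)
    obtain ⟨a, c, hc⟩ := hsurj M (hPW hMP) hM0' (hP M hMP hM0')
    have hc0 : c ≠ 0 := fun h => hM0' (by simp [hc, h])
    have hfa : f a ∈ P := by
      rw [hc] at hMP
      exact (P.smul_mem_iff hc0).1 hMP
    have : Module.Finite F P := Module.finite_of_finrank_pos (by omega)
    refine ⟨a, Subtype.ext (Submodule.eq_of_le_of_finrank_eq (by simpa using hfa) ?_)⟩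
    rw [hP1, finrank_span_singleton (hf0 a)]

end Sigma11



theorem sigma11_point_orbit_distribution (h : ℕ) (hh : 0 < h)
    (F : Type) [Field F] [Fintype F] (hF : Fintype.card F = 2 ^ h)
    (W : Submodule F (Matrix (Fin 3) (Fin 3) F))
    (hW : (W : Set (Matrix (Fin 3) (Fin 3) F)) =
      {M | ∃ x y z : F, M = !![x, y, 0; y, z, z; 0, z, x + z]}) :
    Nat.card {P | IsPointOf F W P (fun M => M.rank = 1)} = 1 ∧
    Nat.card {P | IsPointOf F W P (fun M => M.rank = 2 ∧ ∀ i, M i i = 0)} = 1 ∧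
    Nat.card {P | IsPointOf F W P (fun M => M.rank = 2 ∧ ∃ i, M i i ≠ 0)} = 2 ^ h - 1 ∧
    Nat.card {P | IsPointOf F W P (fun M => M.rank = 3)} = (2 ^ h) ^ 2 := by
  have h2 : (2 : F) = 0 := by
    have hc := FiniteField.cast_card_eq_zero F
    rw [hF] at hc
    push_cast at hc
    exact eq_zero_of_pow_eq_zero hc
  have hmem (M) : M ∈ W ↔ ∃ x y z, M = sigma11Matrix x y z := Set.ext_iff.1 hW M
  have hmat (x y z : F) : sigma11Matrix x y z ∈ W := (hmem _).2 ⟨x, y, z, rfl⟩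
  refine ⟨?_, ?_, ?_, ?_⟩
  · refine (natCard_isPointOf (α := Unit) (fun _ => sigma11Matrix 0 0 1) (fun _ => hmat _ _ _)
      (fun _ => by simp [sigma11Matrix_eq_zero]) (fun _ c hc => ?_) (fun _ _ _ _ => rfl) ?_).trans
      Nat.card_unique
    · rw [smul_sigma11Matrix, rank_sigma11Matrix_eq_one] <;> simp [sigma11Matrix_eq_zero, hc]
    · intro M hM hM0 hr
      obtain ⟨x, y, z, rfl⟩ := (hmem M).1 hM
      obtain ⟨rfl, rfl⟩ := (rank_sigma11Matrix_eq_one hM0).1 hr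
      exact ⟨(), z, by simp [smul_sigma11Matrix]⟩
  · refine (natCard_isPointOf (α := Unit) (fun _ => sigma11Matrix 0 1 0) (fun _ => hmat _ _ _)
      (fun _ => by simp [sigma11Matrix_eq_zero]) (fun _ c hc => ?_) (fun _ _ _ _ => rfl) ?_).trans
      Nat.card_unique
    · rw [smul_sigma11Matrix, rank_two_diag_zero_iff h2] <;> simp [sigma11Matrix_eq_zero, hc]
    · intro M hM hM0 hr
      obtain ⟨x, y, z, rfl⟩ := (hmem M).1 hM
      obtain ⟨rfl, rfl⟩ := (rank_two_diag_zero_iff h2 hM0).1 hr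
      exact ⟨(), y, by simp [smul_sigma11Matrix]⟩
  · have hcard : Nat.card {y : F // 1 + y ≠ 0} = 2 ^ h - 1 := by
      classical
      rw [← hF, ← Nat.card_eq_fintype_card, ← Nat.card_units F]
      exact Nat.card_congr (((Equiv.addLeft (1 : F)).subtypeEquiv fun _ => Iff.rfl).trans
        unitsEquivNeZero.symm)
    rw [← hcard]
    refine natCard_isPointOf
      (fun y : {y : F // 1 + y ≠ 0} => sigma11Matrix 1 y.1 (y.1 ^ 2 / (1 + y.1) ^ 2))
      (fun _ => hmat _ _ _) (fun _ => by simp [sigma11Matrix_eq_zero]) ?_ ?_ ?_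
    · rintro ⟨y, hy⟩ c hc
      rw [smul_sigma11Matrix, rank_two_diag_ne_zero_iff h2]
      refine ⟨by simpa using hc, ?_⟩
      field_simp
    · rintro ⟨y, hy⟩ ⟨y', hy'⟩ c hc
      rw [smul_sigma11Matrix, sigma11Matrix_inj] at hc
      obtain ⟨h1, h3, -⟩ := hc
      rw [mul_one] at h1
      simpa [← h1] using h3
    · intro M hM hM0 hr
      obtain ⟨x, y, z, rfl⟩ := (hmem M).1 hM
      obtain ⟨hx, hd⟩ := (rank_two_diag_ne_zero_iff h2).1 hr
      have hxy : x + y ≠ 0 := by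
        intro hxy
        rw [hxy] at hd
        have hy : y = 0 := by simpa [hx] using hd.symm
        exact hx (by simpa [hy] using hxy)
      have hxy' : 1 + y / x ≠ 0 := by
        rw [← div_self hx, ← add_div]
        exact div_ne_zero hxy hx
      refine ⟨⟨y / x, hxy'⟩, x, ?_⟩
      rw [smul_sigma11Matrix, sigma11Matrix_inj]
      refine ⟨by simp, by field_simp, ?_⟩
      field_simp
      linear_combination hd
  · classical
    have hcard : Nat.card (F × F) = (2 ^ h) ^ 2 := by
      rw [Nat.card_prod, Nat.card_eq_fintype_card, hF, sq]
    rw [← hcard]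
    refine natCard_isPointOf
      (fun p : F × F => if p.2 * (1 + p.1) ^ 2 ≠ p.1 ^ 2 then sigma11Matrix 1 p.1 p.2
        else sigma11Matrix 0 1 (1 + p.1)) ?_ ?_ ?_ ?_ ?_
    · intro p
      split_ifs <;> exact hmat _ _ _
    · intro p
      split_ifs <;> simp [sigma11Matrix_eq_zero]
    · rintro ⟨y, z⟩ c hc
      dsimp only
      split_ifs with hd <;> rw [smul_sigma11Matrix, rank_sigma11Matrix_eq_three h2]
      · intro hd'
        refine hd (mul_left_cancel₀ (pow_ne_zero 3 hc) ?_)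
        linear_combination hd'
      · have hy : 1 + y ≠ 0 := by
          intro hy
          have hy0 : y = 0 := by simpa [hy] using (not_not.1 hd).symm
          simp [hy0] at hy
        simp [hc, hy]
    · rintro ⟨y, z⟩ ⟨y', z'⟩ c hc
      dsimp only at hc
      split_ifs at hc with hd hd' hd' <;>
        rw [smul_sigma11Matrix, sigma11Matrix_inj] at hc <;> obtain ⟨h1, h3, h4⟩ := hc
      · have hc1 : c = 1 := by simpa using h1.symm
        rw [hc1, one_mul] at h3 h4
        exact Prod.ext h3 h4
      · simp at h1
      · have hc0 : c = 0 := by simpa using h1.symm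
        simp [hc0] at h3
      · have hc1 : c = 1 := by simpa using h3.symm
        have hyy : y = y' := by simpa [hc1] using h4
        subst hyy
        rw [not_not] at hd hd'
        have hy : 1 + y ≠ 0 := by
          intro hy
          have hy0 : y = 0 := by simpa [hy] using hd.symm
          simp [hy0] at hy
        have hz : z = z' := mul_right_cancel₀ (pow_ne_zero 2 hy) (hd.trans hd'.symm)
        rw [hz]
    · intro M hM hM0 hr
      obtain ⟨x, y, z, rfl⟩ := (hmem M).1 hM
      have hd := (rank_sigma11Matrix_eq_three h2 x y z).1 hr
      by_cases hx : x = 0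
      · subst hx
        have hzy : z ≠ 0 ∧ y ≠ 0 := by simpa using hd
        obtain ⟨hz, hy⟩ := hzy
        refine ⟨(z / y - 1, (z / y - 1) ^ 2 / (z / y) ^ 2), y, ?_⟩
        have hs : 1 + (z / y - 1) = z / y := by ring
        have hzy : z / y ≠ 0 := div_ne_zero hz hy
        dsimp only
        rw [hs, if_neg (by simp [hz, hy]), smul_sigma11Matrix, sigma11Matrix_inj]
        exact ⟨by simp, by simp, by field_simp⟩
      · refine ⟨(y / x, z / x), x, ?_⟩
        dsimp only
        rw [if_pos, smul_sigma11Matrix, sigma11Matrix_inj]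
        · exact ⟨by simp, by field_simp, by field_simp⟩
        · intro hd'
          apply hd
          field_simp at hd'
          linear_combination hd'
end

section
/- Let q = 2^h be a power of 2, F a finite field with q elements, and c ∈ F nonzero. Let W_c = { [[x, y, c x], [y, y + z, 0], [c x, 0, c² x + z]] : x, y, z ∈ F } ⊆ Sym₃(F). Then W_c contains exactly one rank-1 point and no nonzero matrix with all diagonal entries 0, and: if Tr(c) = 1, the point-orbit distribution of W_c is [1, 0, q+1, q²−1], while if Tr(c) = 0, the point-orbit distribution of W_c is [1, 0, q−1, q²+1]. -/
open Matrix

/-- The absolute trace map `Tr : F → F₂ ⊆ F` of a finite field `F` of order `2^h`,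
`Tr(x) = x + x² + x⁴ + ⋯ + x^(2^(h-1))`. -/
def AbsTrace (F : Type) [Field F] (h : ℕ) (x : F) : F :=
  ∑ i ∈ Finset.range h, x ^ 2 ^ i

namespace Matrix

variable {F : Type*} [Field F]

theorem rank_eq_card_iff_det_ne_zero_s16 {n : Type*} [Fintype n] [DecidableEq n] (A : Matrix n n F) :
    A.rank = Fintype.card n ↔ A.det ≠ 0 := by
  refine ⟨fun hA => ?_, rank_of_det_ne_zero⟩
  have htop : LinearMap.range A.mulVecLin = ⊤ :=
    Submodule.eq_top_of_finrank_eq (by rw [Module.finrank_pi]; exact hA)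
  have hs : Function.Surjective A.mulVec := LinearMap.range_eq_top.mp htop
  exact ((isUnit_iff_isUnit_det A).mp (mulVec_surjective_iff_isUnit.mp hs)).ne_zero

theorem one_lt_rank_of_minor_ne_zero {m n : Type*} [Fintype m] [Fintype n] (A : Matrix m n F)
    (i k : m) (j l : n) (hA : A i j * A k l - A i l * A k j ≠ 0) : 1 < A.rank := by
  have hle := rank_submatrix_le A ![i, k] ![j, l]
  have hdet : (A.submatrix ![i, k] ![j, l]).det ≠ 0 := by
    rw [det_fin_two]
    exact hA
  rw [rank_of_det_ne_zero hdet, Fintype.card_fin] at hle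
  omega

theorem rank_pos_of_ne_zero {m n : Type*} [Fintype n] [DecidableEq n] {A : Matrix m n F}
    (hA : A ≠ 0) : 0 < A.rank := by
  refine Nat.pos_of_ne_zero fun h0 => hA ?_
  have hbot := LinearMap.range_eq_bot.mp (Submodule.finrank_eq_zero.mp h0)
  ext i j
  simpa using congr_fun (LinearMap.congr_fun hbot (Pi.single j 1)) i

theorem rank_smul_of_ne_zero {m n : Type*} [Fintype n] (A : Matrix m n F) {a : F}
    (ha : a ≠ 0) : (a • A).rank = A.rank :=
  rank_smul_of_mem_nonZeroDivisors A (mem_nonZeroDivisors_of_ne_zero ha)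

end Matrix

section AbsTrace

variable {F : Type} [Field F] [Fintype F] {h : ℕ}

theorem charP_two_of_card_eq_two_pow (hF : Fintype.card F = 2 ^ h) : CharP F 2 := by
  obtain ⟨p, hp, n, hpp, hcard⟩ := FiniteField.card' F
  have hdvd : p ∣ 2 ^ h := hF ▸ hcard ▸ dvd_pow_self p n.pos.ne'
  have : p = 2 := (Nat.prime_dvd_prime_iff_eq hpp Nat.prime_two).mp (hpp.dvd_of_dvd_pow hdvd)
  exact this ▸ hp

theorem sum_sq_add_self_pow_two_pow {K : Type*} [CommRing K] [CharP K 2] (a : K) (n : ℕ) :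
    ∑ i ∈ Finset.range n, (a ^ 2 + a) ^ 2 ^ i = a ^ 2 ^ n + a := by
  induction n with
  | zero => simp [CharTwo.add_self_eq_zero]
  | succ n ih =>
    have h2 : (2 : K) = 0 := CharTwo.two_eq_zero
    rw [Finset.sum_range_succ, ih, add_pow_char_pow, ← pow_mul, ← pow_succ']
    linear_combination a ^ 2 ^ n * h2

theorem absTrace_sq_add_self (hF : Fintype.card F = 2 ^ h) (a : F) :
    AbsTrace F h (a ^ 2 + a) = 0 := by
  have := charP_two_of_card_eq_two_pow hF
  rw [AbsTrace, sum_sq_add_self_pow_two_pow, ← hF, FiniteField.pow_card, CharTwo.add_self_eq_zero]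

theorem absTrace_add (hF : Fintype.card F = 2 ^ h) (a b : F) :
    AbsTrace F h (a + b) = AbsTrace F h a + AbsTrace F h b := by
  have := charP_two_of_card_eq_two_pow hF
  simp only [AbsTrace, add_pow_char_pow, Finset.sum_add_distrib]

theorem absTrace_sq (hF : Fintype.card F = 2 ^ h) (a : F) :
    AbsTrace F h (a ^ 2) = AbsTrace F h a := by
  have := charP_two_of_card_eq_two_pow hF
  have := absTrace_sq_add_self hF a
  rw [absTrace_add hF] at this
  exact CharTwo.add_eq_zero.mp this

theorem exists_sq_add_self_eq (hF : Fintype.card F = 2 ^ h) {b : F} (hb : AbsTrace F h b = 0) :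
    ∃ z : F, z ^ 2 + z = b := by
  have := charP_two_of_card_eq_two_pow hF
  let i := algebraMap F (AlgebraicClosure F)
  have : CharP (AlgebraicClosure F) 2 := charP_of_injective_algebraMap i.injective 2
  obtain ⟨α, hα⟩ : ∃ α : AlgebraicClosure F, α ^ 2 + α = i b := by
    obtain ⟨α, hα⟩ := IsAlgClosed.exists_eval₂_eq_zero i
      (Polynomial.X ^ 2 + Polynomial.X - Polynomial.C b) (by
        have : (Polynomial.X ^ 2 + Polynomial.X - Polynomial.C b).degree = 2 := by compute_degree!
        simp [this])
    exact ⟨α, by simpa [sub_eq_zero] using hα⟩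
  have hfix : α ^ Fintype.card F = α := by
    have hsum := sum_sq_add_self_pow_two_pow α h
    have hmap : ∑ j ∈ Finset.range h, (i b) ^ 2 ^ j = 0 := by
      rw [← map_zero i, ← hb, AbsTrace, map_sum]
      simp
    rw [hα, hmap, ← hF] at hsum
    exact CharTwo.add_eq_zero.mp hsum.symm
  have hsplit : (Polynomial.X ^ Fintype.card F - Polynomial.X : Polynomial F).Splits := by
    simpa using (FiniteField.isSplittingField_sub F F).splits'
  obtain ⟨z, hz⟩ := hsplit.mem_range_of_isRoot
    (FiniteField.X_pow_card_sub_X_ne_zero F Fintype.one_lt_card) (i := i) (x := α)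
    (by simp [hfix])
  refine ⟨z, i.injective ?_⟩
  rw [map_add, map_pow, hz, hα]

/-- The quadratic `z² + z + b` over a field of order `2 ^ h` has no root if `b` has absolute trace
`1`. -/
theorem card_ne_sq_add_self_of_absTrace_eq_one (hF : Fintype.card F = 2 ^ h) {b : F}
    (hb : AbsTrace F h b = 1) : Nat.card {z : F // z ^ 2 + z ≠ b} = 2 ^ h := by
  have hne : ∀ z : F, z ^ 2 + z ≠ b := by
    rintro z rfl
    exact zero_ne_one ((absTrace_sq_add_self hF z).symm.trans hb)
  rw [Nat.card_congr (Equiv.subtypeUnivEquiv hne), Nat.card_eq_fintype_card, hF]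

/-- The quadratic `z² + z + b` over a field of order `2 ^ h` has exactly two roots if `b` has
absolute trace `0`. -/
theorem card_ne_sq_add_self_of_absTrace_eq_zero (hF : Fintype.card F = 2 ^ h) {b : F}
    (hb : AbsTrace F h b = 0) : Nat.card {z : F // z ^ 2 + z ≠ b} = 2 ^ h - 2 := by
  classical
  have := charP_two_of_card_eq_two_pow hF
  obtain ⟨α, hα⟩ := exists_sq_add_self_eq hF hb
  have h2 : (2 : F) = 0 := CharTwo.two_eq_zero
  have hset : (Finset.univ.filter fun z : F => z ^ 2 + z ≠ b) = {α, α + 1}ᶜ := by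
    ext z
    simp only [Finset.mem_filter, Finset.mem_univ, true_and, Finset.mem_compl, Finset.mem_insert,
      Finset.mem_singleton, not_iff_not]
    constructor
    · intro hz
      have : (z - α) * (z - (α + 1)) = 0 := by
        linear_combination hz - hα + (-z * α + α ^ 2 + α - z) * h2
      simpa [sub_eq_zero] using this
    · rintro (rfl | rfl)
      · exact hα
      · linear_combination hα + (α + 1) * h2
  rw [Nat.card_eq_fintype_card, Fintype.card_subtype, hset, Finset.card_compl, hF,
    Finset.card_pair (by simp)]

end AbsTrace

section ProjectivePlane

variable {F : Type} [Field F]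

/-- The general matrix of the plane `π_c`. -/
def planeMatrix (c x y z : F) : Matrix (Fin 3) (Fin 3) F :=
  !![x, y, c * x; y, y + z, 0; c * x, 0, c ^ 2 * x + z]

theorem smul_planeMatrix (a c x y z : F) :
    a • planeMatrix c x y z = planeMatrix c (a * x) (a * y) (a * z) := by
  ext i j
  fin_cases i <;> fin_cases j <;> simp [planeMatrix] <;> ring

theorem planeMatrix_inj {c x y z x' y' z' : F} :
    planeMatrix c x y z = planeMatrix c x' y' z' ↔ x = x' ∧ y = y' ∧ z = z' := by
  refine ⟨fun heq => ?_, by rintro ⟨rfl, rfl, rfl⟩; rfl⟩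
  have h0 := congr_fun₂ heq 0 0
  have h1 := congr_fun₂ heq 0 1
  have h2 := congr_fun₂ heq 1 1
  simp [planeMatrix] at h0 h1 h2
  grind

theorem planeMatrix_eq_zero {c x y z : F} : planeMatrix c x y z = 0 ↔ x = 0 ∧ y = 0 ∧ z = 0 := by
  rw [← planeMatrix_inj (c := c)]
  have : planeMatrix c 0 0 0 = 0 := by simpa using (smul_planeMatrix 0 c 0 0 0).symm
  rw [this]

/-- Normalized representatives of the points of the plane `π_c`. -/
def planeRep (c : F) : (F × F) ⊕ F ⊕ Unit → Matrix (Fin 3) (Fin 3) F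
  | .inl (x, z) => planeMatrix c x 1 z
  | .inr (.inl x) => planeMatrix c x 0 1
  | .inr (.inr _) => planeMatrix c 1 0 0

theorem planeRep_ne_zero (c : F) (s) : planeRep c s ≠ 0 := by
  rcases s with ⟨x, z⟩ | x | _ <;> simp [planeRep, planeMatrix_eq_zero]

theorem span_planeRep_injective (c : F) :
    Function.Injective fun s => Submodule.span F {planeRep c s} := by
  intro s t hst
  obtain ⟨a, ha⟩ := Submodule.span_singleton_eq_span_singleton.mp hst
  rw [Units.smul_def] at ha
  have := a.ne_zero
  rcases s with ⟨x, z⟩ | x | _ <;> rcases t with ⟨x', z'⟩ | x' | _ <;>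
    simp [planeRep, smul_planeMatrix, planeMatrix_inj] at ha <;> aesop

theorem exists_smul_planeRep_eq {c x y z : F} (hM : planeMatrix c x y z ≠ 0) :
    ∃ a : F, a ≠ 0 ∧ ∃ s, planeMatrix c x y z = a • planeRep c s := by
  by_cases hy : y = 0
  · by_cases hz : z = 0
    · refine ⟨x, ?_, .inr (.inr ()), ?_⟩
      · simpa [planeMatrix_eq_zero, hy, hz] using hM
      · simp [planeRep, smul_planeMatrix, hy, hz]
    · exact ⟨z, hz, .inr (.inl (x / z)), by
        simp [planeRep, smul_planeMatrix, hy, mul_div_cancel₀ _ hz]⟩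
  · exact ⟨y, hy, .inl (x / y, z / y), by
      simp [planeRep, smul_planeMatrix, mul_div_cancel₀ _ hy]⟩

variable {c : F} {W : Submodule F (Matrix (Fin 3) (Fin 3) F)}
  {pred : Matrix (Fin 3) (Fin 3) F → Prop}

theorem setOf_isPointOf_eq_image
    (hW : ∀ M, M ∈ W ↔ ∃ x y z : F, M = planeMatrix c x y z)
    (hpred : ∀ (a : F) M, a ≠ 0 → pred M → pred (a • M)) :
    {P | IsPointOf F W P pred} =
      (fun s => Submodule.span F {planeRep c s}) '' {s | pred (planeRep c s)} := by
  ext P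
  constructor
  · rintro ⟨hPW, hP1, hP⟩
    obtain ⟨v, hv0, hv⟩ := finrank_eq_one_iff'.mp hP1
    obtain ⟨x, y, z, hxyz⟩ := (hW v).mp (hPW v.2)
    have hv0' : (v : Matrix (Fin 3) (Fin 3) F) ≠ 0 := by simpa using hv0
    obtain ⟨a, ha, s, hs⟩ := exists_smul_planeRep_eq (hxyz ▸ hv0')
    have hs' : planeRep c s = a⁻¹ • (v : Matrix (Fin 3) (Fin 3) F) := by
      rw [hxyz, hs, inv_smul_smul₀ ha]
    have hsP : planeRep c s ∈ P := hs' ▸ P.smul_mem _ v.2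
    refine ⟨s, hP _ hsP (planeRep_ne_zero c s), le_antisymm ?_ ?_⟩
    · simpa using hsP
    · intro M hM
      obtain ⟨b, hb⟩ := hv ⟨M, hM⟩
      refine Submodule.mem_span_singleton.mpr ⟨b * a, ?_⟩
      rw [mul_smul, ← hs, ← hxyz]
      exact congr_arg Subtype.val hb
  · rintro ⟨s, hs, rfl⟩
    refine ⟨?_, finrank_span_singleton (planeRep_ne_zero c s), fun M hM hM0 => ?_⟩
    · rw [Submodule.span_singleton_le_iff_mem, hW]
      rcases s with ⟨x, z⟩ | x | _ <;> exact ⟨_, _, _, rfl⟩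
    · obtain ⟨a, rfl⟩ := Submodule.mem_span_singleton.mp hM
      exact hpred a _ (by rintro rfl; simp at hM0) hs

theorem card_isPointOf [Finite F]
    (hW : ∀ M, M ∈ W ↔ ∃ x y z : F, M = planeMatrix c x y z)
    (hpred : ∀ (a : F) M, a ≠ 0 → pred M → pred (a • M)) :
    Nat.card {P | IsPointOf F W P pred} =
      Nat.card {p : F × F // pred (planeMatrix c p.1 1 p.2)} +
        (Nat.card {x : F // pred (planeMatrix c x 0 1)} +
          Nat.card {_u : Unit // pred (planeMatrix c 1 0 0)}) := by
  rw [setOf_isPointOf_eq_image hW hpred, Nat.card_image_of_injective (span_planeRep_injective c)]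
  calc Nat.card {s // pred (planeRep c s)}
      = _ := Nat.card_congr Equiv.subtypeSum
    _ = _ := by
      rw [Nat.card_sum, Nat.card_congr (Equiv.subtypeSum (p := fun s => pred (planeRep c (.inr s)))),
        Nat.card_sum]
      rfl

theorem planeMatrix_rank_one (c : F) : (planeMatrix c 1 0 0).rank = 1 := by
  have heq : planeMatrix c 1 0 0 = vecMulVec ![1, 0, c] ![1, 0, c] := by
    ext i j
    fin_cases i <;> fin_cases j <;> simp [planeMatrix, vecMulVec_apply, sq]
  have hpos := rank_pos_of_ne_zero (A := planeMatrix c 1 0 0) (by simp [planeMatrix_eq_zero])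
  have := heq ▸ rank_vecMulVec_le (R := F) ![1, 0, c] ![1, 0, c]
  omega

theorem one_lt_rank_planeMatrix {x y z : F} (hc : c ≠ 0) (hyz : y ≠ 0 ∨ z ≠ 0) :
    1 < (planeMatrix c x y z).rank := by
  by_contra hle
  have hminor (i k j l : Fin 3) :=
    not_imp_comm.mp (one_lt_rank_of_minor_ne_zero (planeMatrix c x y z) i k j l) hle
  have h1 := hminor 0 1 0 1
  have h2 := hminor 0 1 0 2
  have h3 := hminor 0 1 1 2
  have h4 := hminor 0 2 0 2
  have h5 := hminor 1 2 1 2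
  simp [planeMatrix] at h1 h2 h3 h4 h5
  grind

theorem det_planeMatrix [CharP F 2] (c x y z : F) :
    (planeMatrix c x y z).det = x * (z ^ 2 + y * z + c ^ 2 * y ^ 2) + y ^ 2 * z := by
  have h2 : (2 : F) = 0 := CharTwo.two_eq_zero
  simp [planeMatrix, det_fin_three]
  linear_combination (-c ^ 2 * x * y ^ 2 - y ^ 2 * z) * h2

theorem rank_planeMatrix_eq_three_iff (c x y z : F) :
    (planeMatrix c x y z).rank = 3 ↔ (planeMatrix c x y z).det ≠ 0 := by
  simpa using rank_eq_card_iff_det_ne_zero_s16 (planeMatrix c x y z)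

theorem rank_planeMatrix_eq_two_iff {x y z : F} (hc : c ≠ 0) (hyz : y ≠ 0 ∨ z ≠ 0) :
    (planeMatrix c x y z).rank = 2 ↔ (planeMatrix c x y z).det = 0 := by
  have h1 := one_lt_rank_planeMatrix (x := x) hc hyz
  have h3 := rank_le_width (planeMatrix c x y z)
  have := rank_planeMatrix_eq_three_iff c x y z
  rw [← not_iff_not, ← Ne, ← Ne, ← this]
  omega

theorem eq_zero_of_diag_planeMatrix [CharP F 2] {x y z : F}
    (hd : ∀ i, planeMatrix c x y z i i = 0) : planeMatrix c x y z = 0 := by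
  have h0 := hd 0
  have h1 := hd 1
  have h2 := hd 2
  simp [planeMatrix] at h0 h1 h2
  rw [planeMatrix_eq_zero]
  grind

theorem card_det_planeMatrix_y_one_eq_zero [CharP F 2] (hc : c ≠ 0) :
    Nat.card {p : F × F // (planeMatrix c p.1 1 p.2).det = 0} =
      Nat.card {z : F // z ^ 2 + z ≠ c ^ 2} := by
  have h2 : (2 : F) = 0 := CharTwo.two_eq_zero
  have hne {z : F} (hz : z ^ 2 + z ≠ c ^ 2) : z ^ 2 + z + c ^ 2 ≠ 0 :=
    fun h0 => hz (CharTwo.add_eq_zero.mp h0)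
  have hdet {x z : F} (hp : (planeMatrix c x 1 z).det = 0) : z ^ 2 + z ≠ c ^ 2 := fun hz => by
    rw [det_planeMatrix] at hp
    have hz0 : z = 0 := by linear_combination hp - x * hz - x * c ^ 2 * h2
    subst hz0
    exact hc (by simpa using hz.symm)
  refine Nat.card_congr
    { toFun := fun p => ⟨p.1.2, hdet p.2⟩
      invFun := fun z => ⟨(z.1 / (z.1 ^ 2 + z.1 + c ^ 2), z.1), ?_⟩
      left_inv := ?_
      right_inv := fun z => rfl }
  · obtain ⟨z, hz⟩ := z
    have := hne hz
    rw [det_planeMatrix]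
    simp only [one_mul, one_pow, mul_one]
    rw [div_mul_cancel₀ _ this, CharTwo.add_self_eq_zero]
  · rintro ⟨⟨x, z⟩, hp⟩
    ext
    · simp only
      rw [div_eq_iff (hne (hdet hp))]
      rw [det_planeMatrix] at hp
      linear_combination -hp + z * h2
    · rfl

theorem card_det_planeMatrix_y_zero_eq_zero [CharP F 2] (c : F) :
    Nat.card {x : F // (planeMatrix c x 0 1).det = 0} = 1 := by
  simp [det_planeMatrix]

theorem card_subtype_not {α : Type*} [Finite α] (p : α → Prop) :
    Nat.card {a // ¬ p a} = Nat.card α - Nat.card {a // p a} := by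
  classical
  have := Fintype.ofFinite α
  simp only [Nat.card_eq_fintype_card, Fintype.card_subtype_compl]

/-- The plane `π_c` has a single point of rank one. -/
theorem card_rank_one_points [Finite F] (hc : c ≠ 0)
    (hW : ∀ M, M ∈ W ↔ ∃ x y z : F, M = planeMatrix c x y z) :
    Nat.card {P | IsPointOf F W P (fun M => M.rank = 1)} = 1 := by
  rw [card_isPointOf hW fun a M ha hM => by rwa [rank_smul_of_ne_zero M ha]]
  have h1 (x z : F) : (planeMatrix c x 1 z).rank ≠ 1 :=
    (one_lt_rank_planeMatrix hc (.inl one_ne_zero)).ne'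
  have h2 (x : F) : (planeMatrix c x 0 1).rank ≠ 1 :=
    (one_lt_rank_planeMatrix hc (.inr one_ne_zero)).ne'
  simp [h1, h2, planeMatrix_rank_one]

theorem diag_eq_zero_imp_eq_zero [CharP F 2]
    (hW : ∀ M, M ∈ W ↔ ∃ x y z : F, M = planeMatrix c x y z)
    (M : Matrix (Fin 3) (Fin 3) F) (hM : M ∈ W) (hd : ∀ i, M i i = 0) : M = 0 := by
  obtain ⟨x, y, z, rfl⟩ := (hW M).mp hM
  exact eq_zero_of_diag_planeMatrix hd

/-- The plane `π_c` has no points in the nucleus plane. -/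
theorem card_rank_two_diag_eq_zero_points [CharP F 2]
    (hW : ∀ M, M ∈ W ↔ ∃ x y z : F, M = planeMatrix c x y z) :
    Nat.card {P | IsPointOf F W P (fun M => M.rank = 2 ∧ ∀ i, M i i = 0)} = 0 := by
  rw [Nat.card_eq_zero]
  refine .inl ⟨fun ⟨P, hPW, hP1, hP⟩ => ?_⟩
  obtain ⟨v, hv0, -⟩ := finrank_eq_one_iff'.mp hP1
  have hv0' : (v : Matrix (Fin 3) (Fin 3) F) ≠ 0 := by simpa using hv0
  exact hv0' (diag_eq_zero_imp_eq_zero hW v (hPW v.2) (hP v v.2 hv0').2)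

theorem card_rank_two_diag_ne_zero_points [Finite F] [CharP F 2] (hc : c ≠ 0)
    (hW : ∀ M, M ∈ W ↔ ∃ x y z : F, M = planeMatrix c x y z) :
    Nat.card {P | IsPointOf F W P (fun M => M.rank = 2 ∧ ∃ i, M i i ≠ 0)} =
      Nat.card {z : F // z ^ 2 + z ≠ c ^ 2} + 1 := by
  rw [card_isPointOf hW fun a M ha hM => by simpa [rank_smul_of_ne_zero M ha, ha] using hM]
  have hdiag {x y z : F} (hyz : y ≠ 0 ∨ z ≠ 0) :
      (planeMatrix c x y z).rank = 2 ∧ (∃ i, planeMatrix c x y z i i ≠ 0) ↔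
        (planeMatrix c x y z).det = 0 := by
    rw [rank_planeMatrix_eq_two_iff hc hyz, and_iff_left]
    by_contra! hd
    have := planeMatrix_eq_zero.mp (eq_zero_of_diag_planeMatrix hd)
    tauto
  simp only [hdiag (.inl one_ne_zero), hdiag (.inr one_ne_zero),
    card_det_planeMatrix_y_one_eq_zero hc, card_det_planeMatrix_y_zero_eq_zero,
    planeMatrix_rank_one]
  simp

theorem card_rank_three_points [Finite F] [CharP F 2] (hc : c ≠ 0)
    (hW : ∀ M, M ∈ W ↔ ∃ x y z : F, M = planeMatrix c x y z) :
    Nat.card {P | IsPointOf F W P (fun M => M.rank = 3)} =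
      Nat.card F ^ 2 - Nat.card {z : F // z ^ 2 + z ≠ c ^ 2} + (Nat.card F - 1) := by
  rw [card_isPointOf hW fun a M ha hM => by rwa [rank_smul_of_ne_zero M ha]]
  simp only [rank_planeMatrix_eq_three_iff, Ne, card_subtype_not,
    card_det_planeMatrix_y_one_eq_zero hc, card_det_planeMatrix_y_zero_eq_zero, Nat.card_prod, sq]
  simp [det_planeMatrix]

end ProjectivePlane

/-- The plane `π_c` (representative of `Σ₁₂`, `Σ₁₃` or `Σ₁₄`) has a unique rank-1 point, meets
the nucleus plane trivially, and has point-orbit distribution `[1, 0, q+1, q²-1]` if `Tr(c) = 1`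
and `[1, 0, q-1, q²+1]` if `Tr(c) = 0`. -/
theorem pi_c_point_orbit_distribution (h : ℕ) (hh : 0 < h)
    (F : Type) [Field F] [Fintype F] (hF : Fintype.card F = 2 ^ h)
    (c : F) (hc : c ≠ 0)
    (W : Submodule F (Matrix (Fin 3) (Fin 3) F))
    (hW : (W : Set (Matrix (Fin 3) (Fin 3) F)) =
      {M | ∃ x y z : F, M = !![x, y, c * x; y, y + z, 0; c * x, 0, c ^ 2 * x + z]}) :
    Nat.card {P | IsPointOf F W P (fun M => M.rank = 1)} = 1 ∧
    (∀ M ∈ W, (∀ i, M i i = 0) → M = 0) ∧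
    (AbsTrace F h c = 1 →
      Nat.card {P | IsPointOf F W P (fun M => M.rank = 2 ∧ ∀ i, M i i = 0)} = 0 ∧
      Nat.card {P | IsPointOf F W P (fun M => M.rank = 2 ∧ ∃ i, M i i ≠ 0)} = 2 ^ h + 1 ∧
      Nat.card {P | IsPointOf F W P (fun M => M.rank = 3)} = (2 ^ h) ^ 2 - 1) ∧
    (AbsTrace F h c = 0 →
      Nat.card {P | IsPointOf F W P (fun M => M.rank = 2 ∧ ∀ i, M i i = 0)} = 0 ∧
      Nat.card {P | IsPointOf F W P (fun M => M.rank = 2 ∧ ∃ i, M i i ≠ 0)} = 2 ^ h - 1 ∧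
      Nat.card {P | IsPointOf F W P (fun M => M.rank = 3)} = (2 ^ h) ^ 2 + 1) := by
  have := charP_two_of_card_eq_two_pow hF
  have hW' : ∀ M, M ∈ W ↔ ∃ x y z : F, M = planeMatrix c x y z := fun M => by
    rw [← SetLike.mem_coe, hW]
    rfl
  have hq : 2 ≤ 2 ^ h := Nat.le_self_pow hh.ne' 2
  have hq2 : 2 ^ h ≤ (2 ^ h) ^ 2 := Nat.le_self_pow two_ne_zero _
  have hcard : Nat.card F = 2 ^ h := by rw [Nat.card_eq_fintype_card, hF]
  rw [card_rank_two_diag_eq_zero_points hW', card_rank_two_diag_ne_zero_points hc hW',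
    card_rank_three_points hc hW', hcard]
  refine ⟨card_rank_one_points hc hW', diag_eq_zero_imp_eq_zero hW', fun htr => ?_, fun htr => ?_⟩
  · rw [card_ne_sq_add_self_of_absTrace_eq_one hF ((absTrace_sq hF c).trans htr)]
    omega
  · rw [card_ne_sq_add_self_of_absTrace_eq_zero hF ((absTrace_sq hF c).trans htr)]
    omega
end

section
/- Let F be the finite field with 4 elements. Let W = { [[x + z, z, z], [z, y + z, z], [z, z, y]] : x, y, z ∈ F } ⊆ Sym₃(F). Then the point-orbit distribution of W is [1, 0, 3, 17]: W has exactly one rank-1 point, no rank-2 points with zero diagonal, exactly 3 rank-2 points with nonzero diagonal, and exactly 17 rank-3 points. -/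
open Matrix

/-- The matrix of the plane `Σ₁₄′` with parameters `x`, `y`, `z`. -/
def sigmaMatrix {F : Type} [Field F] (x y z : F) : Matrix (Fin 3) (Fin 3) F :=
  !![x + z, z, z; z, y + z, z; z, z, y]

/-- The matrices of the plane `Σ₁₄′` whose last nonzero parameter is `1`. -/
def normalizedSigmaMatrix {F : Type} [Field F] :
    Unit ⊕ F ⊕ F × F → Matrix (Fin 3) (Fin 3) F
  | .inl _ => sigmaMatrix 1 0 0
  | .inr (.inl x) => sigmaMatrix x 1 0
  | .inr (.inr (x, y)) => sigmaMatrix x y 1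

section SigmaPlane

variable {F : Type} [Field F]

lemma smul_sigmaMatrix (c x y z : F) :
    c • sigmaMatrix x y z = sigmaMatrix (c * x) (c * y) (c * z) := by
  ext i j
  fin_cases i <;> fin_cases j <;> simp [sigmaMatrix, mul_add]

lemma sigmaMatrix_inj {x y z x' y' z' : F} :
    sigmaMatrix x y z = sigmaMatrix x' y' z' ↔ x = x' ∧ y = y' ∧ z = z' := by
  refine ⟨fun h => ?_, by rintro ⟨rfl, rfl, rfl⟩; rfl⟩
  have h0 := congrFun (congrFun h 0) 0
  have h1 := congrFun (congrFun h 0) 1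
  have h2 := congrFun (congrFun h 2) 2
  simp only [sigmaMatrix, of_apply, cons_val] at h0 h1 h2
  subst h1 h2
  exact ⟨add_right_cancel h0, rfl, rfl⟩

lemma sigmaMatrix_zero : sigmaMatrix (0 : F) 0 0 = 0 := by
  ext i j
  fin_cases i <;> fin_cases j <;> simp [sigmaMatrix]

lemma normalizedSigmaMatrix_ne_zero (t : Unit ⊕ F ⊕ F × F) : normalizedSigmaMatrix t ≠ 0 := by
  rcases t with _ | x | ⟨x, y⟩ <;>
    simp [normalizedSigmaMatrix, ← sigmaMatrix_zero, sigmaMatrix_inj]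

lemma exists_sigmaMatrix_eq_normalizedSigmaMatrix (t : Unit ⊕ F ⊕ F × F) :
    ∃ x y z, normalizedSigmaMatrix t = sigmaMatrix x y z := by
  rcases t with _ | x | ⟨x, y⟩ <;> exact ⟨_, _, _, rfl⟩

lemma exists_smul_normalizedSigmaMatrix {x y z : F} (h : sigmaMatrix x y z ≠ 0) :
    ∃ c : F, c ≠ 0 ∧ ∃ t, sigmaMatrix x y z = c • normalizedSigmaMatrix t := by
  by_cases hz : z = 0
  · by_cases hy : y = 0
    · subst hz hy
      refine ⟨x, ?_, .inl (), by simp [normalizedSigmaMatrix, smul_sigmaMatrix]⟩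
      rintro rfl
      exact h sigmaMatrix_zero
    · refine ⟨y, hy, .inr (.inl (y⁻¹ * x)), ?_⟩
      simp [normalizedSigmaMatrix, smul_sigmaMatrix, hz, hy]
  · refine ⟨z, hz, .inr (.inr (z⁻¹ * x, z⁻¹ * y)), ?_⟩
    simp [normalizedSigmaMatrix, smul_sigmaMatrix, hz]

lemma span_normalizedSigmaMatrix_injective :
    Function.Injective fun t : Unit ⊕ F ⊕ F × F => Submodule.span F {normalizedSigmaMatrix t} := by
  intro s t h
  obtain ⟨c, hc⟩ := Submodule.span_singleton_eq_span_singleton.1 h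
  rw [Units.smul_def] at hc
  rcases s with _ | x | ⟨x, y⟩ <;> rcases t with _ | x' | ⟨x', y'⟩ <;>
    simp only [normalizedSigmaMatrix, smul_sigmaMatrix, sigmaMatrix_inj] at hc <;> aesop

/-- Points of the plane `Σ₁₄′` correspond to normalized parameters. -/
lemma card_setOf_isPointOf {W : Submodule F (Matrix (Fin 3) (Fin 3) F)}
    (hW : (W : Set (Matrix (Fin 3) (Fin 3) F)) = {M | ∃ x y z : F, M = sigmaMatrix x y z})
    {pred : Matrix (Fin 3) (Fin 3) F → Prop}
    (hpred : ∀ c : F, c ≠ 0 → ∀ M, pred M → pred (c • M)) :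
    Nat.card {P | IsPointOf F W P pred} =
      Nat.card {t : Unit ⊕ F ⊕ F × F | pred (normalizedSigmaMatrix t)} := by
  have mem_W (M) : M ∈ W ↔ ∃ x y z : F, M = sigmaMatrix x y z := Set.ext_iff.1 hW M
  rw [← Nat.card_image_of_injective span_normalizedSigmaMatrix_injective]
  congr 2
  ext P
  simp only [Set.mem_image, Set.mem_ofPred_eq]
  constructor
  · rintro ⟨hPW, hP, hpredP⟩
    obtain ⟨⟨M, hM⟩, hM0, hspan⟩ := finrank_eq_one_iff'.1 hP
    have hM0 : M ≠ 0 := by simpa using hM0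
    obtain ⟨x, y, z, rfl⟩ := (mem_W M).1 (hPW hM)
    obtain ⟨c, hc, t, ht⟩ := exists_smul_normalizedSigmaMatrix hM0
    have htP : normalizedSigmaMatrix t ∈ P := by
      rwa [ht, P.smul_mem_iff hc] at hM
    refine ⟨t, hpredP _ htP (normalizedSigmaMatrix_ne_zero t), le_antisymm ?_ ?_⟩
    · rwa [Submodule.span_singleton_le_iff_mem]
    · intro N hN
      obtain ⟨d, hd⟩ := hspan ⟨N, hN⟩
      have hd : d • sigmaMatrix x y z = N := congrArg Subtype.val hd
      rw [Submodule.mem_span_singleton]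
      exact ⟨d * c, by rw [mul_smul, ← ht, hd]⟩
  · rintro ⟨t, ht, rfl⟩
    refine ⟨?_, finrank_span_singleton (normalizedSigmaMatrix_ne_zero t), ?_⟩
    · rw [Submodule.span_singleton_le_iff_mem, mem_W]
      exact exists_sigmaMatrix_eq_normalizedSigmaMatrix t
    · intro M hM hM0
      obtain ⟨c, rfl⟩ := Submodule.mem_span_singleton.1 hM
      exact hpred c (by rintro rfl; simp at hM0) _ ht

lemma Matrix.rank_smul_of_ne_zero_s17 {m n : Type*} [Fintype n] {c : F} (hc : c ≠ 0)
    (M : Matrix m n F) : (c • M).rank = M.rank :=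
  rank_smul_of_mem_nonZeroDivisors M (mem_nonZeroDivisors_of_ne_zero hc)

/-- A matrix with a nonzero `k × k` minor which factors through dimension `k` has rank `k`. -/
lemma Matrix.rank_eq_of_minor_ne_zero_of_eq_mul {k m n : ℕ} {M : Matrix (Fin m) (Fin n) F}
    (r : Fin k → Fin m) (c : Fin k → Fin n) (h : (M.submatrix r c).det ≠ 0)
    (A : Matrix (Fin m) (Fin k) F) (B : Matrix (Fin k) (Fin n) F) (hM : M = A * B) :
    M.rank = k := by
  apply le_antisymm
  · rw [hM]
    exact (rank_mul_le_left A B).trans (rank_le_width A)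
  · simpa [rank_of_det_ne_zero h] using rank_submatrix_le M r c

lemma rank_sigmaMatrix_one_zero_zero : (sigmaMatrix (1 : F) 0 0).rank = 1 := by
  refine rank_eq_of_minor_ne_zero_of_eq_mul ![0] ![0] ?_ !![1; 0; 0] !![1, 0, 0] ?_
  · rw [det_fin_one]
    simp [sigmaMatrix]
  · ext i j
    fin_cases i <;> fin_cases j <;> simp [sigmaMatrix, mul_apply]

lemma rank_sigmaMatrix_zero_one_zero : (sigmaMatrix (0 : F) 1 0).rank = 2 := by
  refine rank_eq_of_minor_ne_zero_of_eq_mul ![1, 2] ![1, 2] ?_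
    !![0, 0; 1, 0; 0, 1] !![0, 1, 0; 0, 0, 1] ?_
  · rw [det_fin_two]
    simp [sigmaMatrix]
  · ext i j
    fin_cases i <;> fin_cases j <;> simp [sigmaMatrix, mul_apply]

lemma rank_sigmaMatrix_zero_zero_one : (sigmaMatrix (0 : F) 0 1).rank = 2 := by
  refine rank_eq_of_minor_ne_zero_of_eq_mul ![1, 2] ![1, 2] ?_
    !![1, 0; 1, 0; 0, 1] !![1, 1, 1; 1, 1, 0] ?_
  · rw [det_fin_two]
    simp [sigmaMatrix]
  · ext i j
    fin_cases i <;> fin_cases j <;> simp [sigmaMatrix, mul_apply]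

lemma rank_sigmaMatrix_zero_one_one (h2 : (2 : F) = 0) : (sigmaMatrix (0 : F) 1 1).rank = 2 := by
  refine rank_eq_of_minor_ne_zero_of_eq_mul ![0, 1] ![0, 1] ?_
    !![1, 0; 0, 1; 1, 0] !![1, 1, 1; 1, 0, 1] ?_
  · rw [det_fin_two]
    simp [sigmaMatrix]
  · ext i j
    fin_cases i <;> fin_cases j <;>
      simp [sigmaMatrix, mul_apply, one_add_one_eq_two, h2]

lemma det_sigmaMatrix (h2 : (2 : F) = 0) (x y z : F) :
    (sigmaMatrix x y z).det = x * (y ^ 2 + y * z + z ^ 2) + y * z * (y + z) := by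
  simp only [sigmaMatrix, det_fin_three, of_apply, cons_val]
  linear_combination (-z ^ 2 * x - z ^ 2 * y) * h2

lemma two_eq_zero_of_card_eq_four [Fintype F] (hF : Fintype.card F = 4) : (2 : F) = 0 := by
  have h : ((Fintype.card F : ℕ) : F) = 0 := Nat.cast_card_eq_zero F
  rw [hF] at h
  have : (2 : F) * 2 = 0 := by
    push_cast at h
    linear_combination h
  simpa using this

lemma det_sigmaMatrix_one_ne_zero [Fintype F] (hF : Fintype.card F = 4) {x y : F}
    (h : ¬(x = 0 ∧ (y = 0 ∨ y = 1))) : (sigmaMatrix x y 1).det ≠ 0 := by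
  have h2 := two_eq_zero_of_card_eq_four hF
  rw [det_sigmaMatrix h2]
  by_cases hy0 : y = 0
  · simp_all
  by_cases hy1 : y = 1
  · subst hy1
    have : x ≠ 0 := by simpa using h
    intro h0
    exact this (by linear_combination h0 - (x + 1) * h2)
  · have hy : y ^ 4 = y := hF ▸ FiniteField.pow_card y
    have hq : y ^ 2 + y + 1 = 0 := by
      have : y * ((y - 1) * (y ^ 2 + y + 1)) = 0 := by linear_combination hy
      simpa [hy0, sub_eq_zero, hy1] using this
    intro h0
    exact one_ne_zero (α := F) (by linear_combination (x + 1) * hq - h0)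

/-- The rank classification of the points of `Σ₁₄′` over the field with four elements. -/
lemma normalizedSigmaMatrix_rank [Fintype F] (hF : Fintype.card F = 4) (t : Unit ⊕ F ⊕ F × F) :
    (t = .inl () ∧ (normalizedSigmaMatrix t).rank = 1) ∨
    (t ∈ ({.inr (.inl 0), .inr (.inr (0, 0)), .inr (.inr (0, 1))} : Set (Unit ⊕ F ⊕ F × F)) ∧
      (normalizedSigmaMatrix t).rank = 2) ∨
    (t ∉ ({.inl (), .inr (.inl 0), .inr (.inr (0, 0)), .inr (.inr (0, 1))} :
      Set (Unit ⊕ F ⊕ F × F)) ∧ (normalizedSigmaMatrix t).rank = 3) := by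
  have h2 := two_eq_zero_of_card_eq_four hF
  rcases t with _ | x | ⟨x, y⟩
  · exact .inl ⟨rfl, rank_sigmaMatrix_one_zero_zero⟩
  · by_cases hx : x = 0
    · subst hx
      exact .inr (.inl ⟨by simp, rank_sigmaMatrix_zero_one_zero⟩)
    · refine .inr (.inr ⟨by simp [hx], ?_⟩)
      exact (rank_of_det_ne_zero (by simpa [normalizedSigmaMatrix, det_sigmaMatrix h2])).trans (by simp)
  · by_cases h : x = 0 ∧ (y = 0 ∨ y = 1)
    · refine .inr (.inl ?_)
      obtain ⟨rfl, rfl | rfl⟩ := h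
      · exact ⟨by simp, rank_sigmaMatrix_zero_zero_one⟩
      · exact ⟨by simp, rank_sigmaMatrix_zero_one_one h2⟩
    · refine .inr (.inr ⟨?_, ?_⟩)
      · simpa [and_or_left] using h
      · exact (rank_of_det_ne_zero (det_sigmaMatrix_one_ne_zero hF h)).trans (by simp)

lemma exists_normalizedSigmaMatrix_diag_ne_zero {t : Unit ⊕ F ⊕ F × F}
    (ht : t ∈ ({.inr (.inl 0), .inr (.inr (0, 0)), .inr (.inr (0, 1))} :
      Set (Unit ⊕ F ⊕ F × F))) : ∃ i, normalizedSigmaMatrix t i i ≠ 0 := by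
  rcases ht with rfl | rfl | rfl
  · exact ⟨2, by simp [normalizedSigmaMatrix, sigmaMatrix]⟩
  · exact ⟨0, by simp [normalizedSigmaMatrix, sigmaMatrix]⟩
  · exact ⟨0, by simp [normalizedSigmaMatrix, sigmaMatrix]⟩

end SigmaPlane

/-- Over `F₄`, the exceptional plane `Σ₁₄′` has point-orbit distribution `[1, 0, 3, 17]`. -/
theorem sigma14'_point_orbit_distribution
    (F : Type) [Field F] [Fintype F] (hF : Fintype.card F = 4)
    (W : Submodule F (Matrix (Fin 3) (Fin 3) F))
    (hW : (W : Set (Matrix (Fin 3) (Fin 3) F)) =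
      {M | ∃ x y z : F, M = !![x + z, z, z; z, y + z, z; z, z, y]}) :
    Nat.card {P | IsPointOf F W P (fun M => M.rank = 1)} = 1 ∧
    Nat.card {P | IsPointOf F W P (fun M => M.rank = 2 ∧ ∀ i, M i i = 0)} = 0 ∧
    Nat.card {P | IsPointOf F W P (fun M => M.rank = 2 ∧ ∃ i, M i i ≠ 0)} = 3 ∧
    Nat.card {P | IsPointOf F W P (fun M => M.rank = 3)} = 17 := by
  have rank_cases := normalizedSigmaMatrix_rank hF
  refine ⟨?_, ?_, ?_, ?_⟩
  · rw [card_setOf_isPointOf hW fun c hc M hM => (rank_smul_of_ne_zero_s17 hc M).trans hM]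
    have : {t : Unit ⊕ F ⊕ F × F | (normalizedSigmaMatrix t).rank = 1} = {.inl ()} := by
      ext t
      have := rank_cases t
      simp only [Set.mem_insert_iff, Set.mem_singleton_iff, Set.mem_ofPred_eq] at this ⊢
      grind
    rw [this, Nat.card_coe_set_eq, Set.ncard_singleton]
  · rw [card_setOf_isPointOf hW fun c hc M hM =>
      ⟨(rank_smul_of_ne_zero_s17 hc M).trans hM.1, fun i => by simp [hM.2 i]⟩]
    have : {t : Unit ⊕ F ⊕ F × F | (normalizedSigmaMatrix t).rank = 2 ∧
        ∀ i, normalizedSigmaMatrix t i i = 0} = ∅ := by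
      rw [Set.eq_empty_iff_forall_notMem]
      rintro t ⟨ht, hdiag⟩
      rcases rank_cases t with h | h | h
      · omega
      · obtain ⟨i, hi⟩ := exists_normalizedSigmaMatrix_diag_ne_zero h.1
        exact hi (hdiag i)
      · omega
    rw [this, Nat.card_coe_set_eq, Set.ncard_empty]
  · rw [card_setOf_isPointOf hW fun c hc M hM =>
      ⟨(rank_smul_of_ne_zero_s17 hc M).trans hM.1, hM.2.imp fun i hi => by simp [hc, hi]⟩]
    have : {t : Unit ⊕ F ⊕ F × F | (normalizedSigmaMatrix t).rank = 2 ∧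
        ∃ i, normalizedSigmaMatrix t i i ≠ 0} =
        {.inr (.inl 0), .inr (.inr (0, 0)), .inr (.inr (0, 1))} := by
      ext t
      have := rank_cases t
      have := exists_normalizedSigmaMatrix_diag_ne_zero (t := t)
      simp only [Set.mem_insert_iff, Set.mem_singleton_iff, Set.mem_ofPred_eq] at *
      grind
    rw [this, Nat.card_coe_set_eq, Set.ncard_eq_three]
    exact ⟨_, _, _, by simp, by simp, by simp, rfl⟩
  · rw [card_setOf_isPointOf hW fun c hc M hM => (rank_smul_of_ne_zero_s17 hc M).trans hM]
    have : {t : Unit ⊕ F ⊕ F × F | (normalizedSigmaMatrix t).rank = 3} =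
        {.inl (), .inr (.inl 0), .inr (.inr (0, 0)), .inr (.inr (0, 1))}ᶜ := by
      ext t
      have := rank_cases t
      simp only [Set.mem_insert_iff, Set.mem_singleton_iff, Set.mem_ofPred_eq,
        Set.mem_compl_iff] at this ⊢
      grind
    rw [this, Nat.card_coe_set_eq, Set.ncard_compl, Set.ncard_insert_of_notMem (by simp),
      Set.ncard_eq_three.2 ⟨_, _, _, by simp, by simp, by simp, rfl⟩]
    simp [Nat.card_eq_fintype_card, hF]
end

section
/- Let q = 2^h be a power of 2 and F a finite field with q elements. Let W₁₅ = { [[x, y, z], [y, z, 0], [z, 0, 0]] : x, y, z ∈ F } ⊆ Sym₃(F). Then every element of W₁₅ of rank at most 2 lies in the 2-dimensional subspace { [[x, y, 0], [y, 0, 0], [0, 0, 0]] : x, y ∈ F } (so W₁₅ is not spanned by its elements of rank at most 2), and the point-orbit distribution of W₁₅ is [1, 1, q−1, q²]: exactly one rank-1 point, exactly one rank-2 point with zero diagonal, exactly q−1 rank-2 points with nonzero diagonal, and exactly q² rank-3 points. -/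
open Matrix

/-- The matrix of `Σ₁₅` with coordinates `x`, `y`, `z`. -/
def sigma15Matrix {F : Type} [Field F] (x y z : F) : Matrix (Fin 3) (Fin 3) F :=
  !![x, y, z; y, z, 0; z, 0, 0]

section Sigma15Matrix

variable {F : Type} [Field F]

lemma sigma15Matrix_inj {x y z x' y' z' : F} :
    sigma15Matrix x y z = sigma15Matrix x' y' z' ↔ x = x' ∧ y = y' ∧ z = z' := by
  constructor
  · intro h
    exact ⟨congrFun₂ h 0 0, congrFun₂ h 0 1, congrFun₂ h 0 2⟩
  · rintro ⟨rfl, rfl, rfl⟩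
    rfl

lemma smul_sigma15Matrix (c x y z : F) :
    c • sigma15Matrix x y z = sigma15Matrix (c * x) (c * y) (c * z) := by
  ext i j
  fin_cases i <;> fin_cases j <;> simp [sigma15Matrix]

lemma sigma15Matrix_eq_zero {x y z : F} :
    sigma15Matrix x y z = 0 ↔ x = 0 ∧ y = 0 ∧ z = 0 := by
  rw [← sigma15Matrix_inj, ← zero_smul F (sigma15Matrix 0 0 0), smul_sigma15Matrix]
  simp

lemma sigma15Matrix_diag_eq_zero {x y z : F} :
    (∀ i, sigma15Matrix x y z i i = 0) ↔ x = 0 ∧ z = 0 := by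
  simp [Fin.forall_fin_succ, sigma15Matrix]

lemma rank_sigma15Matrix_of_ne_zero (x y : F) {z : F} (hz : z ≠ 0) :
    (sigma15Matrix x y z).rank = 3 := by
  simpa using rank_of_det_ne_zero (A := sigma15Matrix x y z)
    (by simp [sigma15Matrix, det_fin_three, hz])

lemma rank_sigma15Matrix_zero_of_ne_zero (x : F) {y : F} (hy : y ≠ 0) :
    (sigma15Matrix x y 0).rank = 2 := by
  apply le_antisymm
  · refine (rank_le_card_of_support_subset _ {0, 1} ?_).trans (by simp)
    rw [Function.support_subset_iff']
    intro i hi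
    ext j
    fin_cases i <;> fin_cases j <;> simp_all [sigma15Matrix]
  · refine le_trans (le_of_eq ?_)
      (rank_submatrix_le (sigma15Matrix x y 0) (![0, 1] : Fin 2 → Fin 3) ![0, 1])
    rw [rank_of_det_ne_zero, Fintype.card_fin]
    rw [det_fin_two]
    simp [sigma15Matrix, hy]

lemma rank_sigma15Matrix_zero_zero_of_ne_zero {x : F} (hx : x ≠ 0) :
    (sigma15Matrix x 0 0).rank = 1 := by
  apply le_antisymm
  · refine (rank_le_card_of_support_subset _ {0} ?_).trans (by simp)
    rw [Function.support_subset_iff']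
    intro i hi
    ext j
    fin_cases i <;> fin_cases j <;> simp_all [sigma15Matrix]
  · refine le_trans (le_of_eq ?_)
      (rank_submatrix_le (sigma15Matrix x 0 0) (![0] : Fin 1 → Fin 3) ![0])
    rw [rank_of_det_ne_zero, Fintype.card_fin]
    rw [det_fin_one]
    simp [sigma15Matrix, hx]

lemma rank_sigma15Matrix [DecidableEq F] (x y z : F) :
    (sigma15Matrix x y z).rank =
      if z ≠ 0 then 3 else if y ≠ 0 then 2 else if x ≠ 0 then 1 else 0 := by
  split_ifs with hz hy hx
  · exact rank_sigma15Matrix_of_ne_zero x y hz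
  · rw [not_not.mp hz, rank_sigma15Matrix_zero_of_ne_zero x hy]
  · rw [not_not.mp hz, not_not.mp hy, rank_sigma15Matrix_zero_zero_of_ne_zero hx]
  · rw [sigma15Matrix_eq_zero.mpr ⟨not_not.mp hx, not_not.mp hy, not_not.mp hz⟩, rank_zero]

end Sigma15Matrix

/-- If every matrix of `W` satisfying `pred` is proportional to exactly one matrix `f a`, then the
points of `W` satisfying `pred` are parametrized by `f`. -/
lemma card_isPointOf_s18 {F : Type} [Field F] {W : Submodule F (Matrix (Fin 3) (Fin 3) F)}
    {pred : Matrix (Fin 3) (Fin 3) F → Prop} {α : Type} (f : α → Matrix (Fin 3) (Fin 3) F)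
    (hW : ∀ a, f a ∈ W) (h_ne : ∀ a, f a ≠ 0) (h_pred : ∀ a (c : F), c ≠ 0 → pred (c • f a))
    (h_inj : ∀ a b (c : F), f a = c • f b → a = b)
    (h_surj : ∀ M ∈ W, M ≠ 0 → pred M → ∃ a, ∃ c : F, M = c • f a) :
    Nat.card {P | IsPointOf F W P pred} = Nat.card α := by
  symm
  refine Nat.card_congr (Equiv.ofBijective (fun a ↦ ⟨Submodule.span F {f a}, ?_, ?_, ?_⟩) ⟨?_, ?_⟩)
  · simpa using hW a
  · exact finrank_span_singleton (h_ne a)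
  · intro M hM hM0
    obtain ⟨c, rfl⟩ := Submodule.mem_span_singleton.mp hM
    exact h_pred a c (by rintro rfl; simp at hM0)
  · intro a b hab
    have hmem : f a ∈ Submodule.span F {f b} := by
      rw [← Subtype.mk.inj hab]
      exact Submodule.mem_span_singleton_self _
    obtain ⟨c, hc⟩ := Submodule.mem_span_singleton.mp hmem
    exact h_inj a b c hc.symm
  · rintro ⟨P, hPW, hP, hP_pred⟩
    obtain ⟨⟨M, hMP⟩, hM0, hM⟩ := finrank_eq_one_iff'.mp hP
    have hM0' : M ≠ 0 := fun h ↦ hM0 (Subtype.ext h)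
    obtain ⟨a, c, rfl⟩ := h_surj M (hPW hMP) hM0' (hP_pred M hMP hM0')
    have hc : c ≠ 0 := by rintro rfl; simp at hM0'
    refine ⟨a, Subtype.ext (le_antisymm ?_ ?_)⟩
    · simpa [smul_smul, hc] using P.smul_mem c⁻¹ hMP
    · intro N hN
      obtain ⟨d, hd⟩ := hM ⟨N, hN⟩
      rw [← show d • c • f a = N from congrArg Subtype.val hd, smul_smul]
      exact Submodule.smul_mem _ _ (Submodule.mem_span_singleton_self _)

/-- Every element of the plane `Σ₁₅` of rank at most `2` lies in a fixed 2-dimensional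
subspace (so `Σ₁₅` is not spanned by its elements of rank at most `2`), and `Σ₁₅` has
point-orbit distribution `[1, 1, q-1, q²]`. -/
theorem sigma15_point_orbit_distribution (h : ℕ) (hh : 0 < h)
    (F : Type) [Field F] [Fintype F] (hF : Fintype.card F = 2 ^ h)
    (W : Submodule F (Matrix (Fin 3) (Fin 3) F))
    (hW : (W : Set (Matrix (Fin 3) (Fin 3) F)) =
      {M | ∃ x y z : F, M = !![x, y, z; y, z, 0; z, 0, 0]}) :
    (∀ M ∈ W, M.rank ≤ 2 → ∃ x y : F, M = !![x, y, 0; y, 0, 0; 0, 0, 0]) ∧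
    Submodule.span F {M : Matrix (Fin 3) (Fin 3) F | M ∈ W ∧ M.rank ≤ 2} ≠ W ∧
    Nat.card {P | IsPointOf F W P (fun M => M.rank = 1)} = 1 ∧
    Nat.card {P | IsPointOf F W P (fun M => M.rank = 2 ∧ ∀ i, M i i = 0)} = 1 ∧
    Nat.card {P | IsPointOf F W P (fun M => M.rank = 2 ∧ ∃ i, M i i ≠ 0)} = 2 ^ h - 1 ∧
    Nat.card {P | IsPointOf F W P (fun M => M.rank = 3)} = (2 ^ h) ^ 2 := by
  classical
  have hmem (x y z : F) : sigma15Matrix x y z ∈ W := by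
    rw [← SetLike.mem_coe, hW]
    exact ⟨x, y, z, rfl⟩
  have hcoord : ∀ M ∈ W, ∃ x y z, M = sigma15Matrix x y z := by
    intro M hM
    rwa [← SetLike.mem_coe, hW] at hM
  have hlow : ∀ M ∈ W, M.rank ≤ 2 → ∃ x y : F, M = sigma15Matrix x y 0 := by
    intro M hM hrank
    obtain ⟨x, y, z, rfl⟩ := hcoord M hM
    obtain rfl : z = 0 := by
      by_contra hz
      simp [rank_sigma15Matrix_of_ne_zero x y hz] at hrank
    exact ⟨x, y, rfl⟩
  refine ⟨hlow, ?_, ?_, ?_, ?_, ?_⟩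
  · intro hspan
    have hle : Submodule.span F {M : Matrix (Fin 3) (Fin 3) F | M ∈ W ∧ M.rank ≤ 2} ≤
        LinearMap.ker (entryLinearMap F F (0 : Fin 3) (2 : Fin 3)) := by
      rw [Submodule.span_le]
      rintro M ⟨hM, hrank⟩
      obtain ⟨x, y, rfl⟩ := hlow M hM hrank
      simp [sigma15Matrix]
    rw [hspan] at hle
    simpa [sigma15Matrix] using hle (hmem 0 0 1)
  · rw [card_isPointOf_s18 (fun _ : Unit ↦ sigma15Matrix (1 : F) 0 0)]
    · simp
    · simp [hmem]
    · simp [sigma15Matrix_eq_zero]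
    · intro _ c hc
      simp [smul_sigma15Matrix, rank_sigma15Matrix, hc]
    · simp
    · intro M hM _ hrank
      obtain ⟨x, y, z, rfl⟩ := hcoord M hM
      rw [rank_sigma15Matrix] at hrank
      refine ⟨(), x, ?_⟩
      rw [smul_sigma15Matrix, sigma15Matrix_inj]
      split_ifs at hrank <;> simp_all
  · rw [card_isPointOf_s18 (fun _ : Unit ↦ sigma15Matrix (0 : F) 1 0)]
    · simp
    · simp [hmem]
    · simp [sigma15Matrix_eq_zero]
    · intro _ c hc
      simp [smul_sigma15Matrix, rank_sigma15Matrix, sigma15Matrix_diag_eq_zero, hc]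
    · simp
    · rintro M hM - ⟨-, hdiag⟩
      obtain ⟨x, y, z, rfl⟩ := hcoord M hM
      obtain ⟨rfl, rfl⟩ := sigma15Matrix_diag_eq_zero.mp hdiag
      exact ⟨(), y, by simp [smul_sigma15Matrix]⟩
  · rw [card_isPointOf_s18 (fun u : Fˣ ↦ sigma15Matrix (u : F) 1 0), Nat.card_units,
      Nat.card_eq_fintype_card, hF]
    · simp [hmem]
    · simp [sigma15Matrix_eq_zero]
    · intro u c hc
      simp only [← not_forall, smul_sigma15Matrix, rank_sigma15Matrix, sigma15Matrix_diag_eq_zero]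
      simp [hc]
    · intro u v c huv
      rw [smul_sigma15Matrix, sigma15Matrix_inj] at huv
      obtain ⟨hu, hc, -⟩ := huv
      rw [mul_one] at hc
      exact Units.ext (by rw [hu, ← hc, one_mul])
    · rintro M hM - ⟨hrank, hdiag⟩
      obtain ⟨x, y, rfl⟩ := hlow M hM hrank.le
      rw [← not_forall, sigma15Matrix_diag_eq_zero] at hdiag
      have hx : x ≠ 0 := fun h ↦ hdiag ⟨h, rfl⟩
      have hy : y ≠ 0 := by
        rintro rfl
        simp [rank_sigma15Matrix_zero_zero_of_ne_zero hx] at hrank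
      refine ⟨Units.mk0 (y⁻¹ * x) (by simp [hx, hy]), y, ?_⟩
      simp [smul_sigma15Matrix, hy]
  · rw [card_isPointOf_s18 (fun p : F × F ↦ sigma15Matrix p.1 p.2 1), Nat.card_prod,
      Nat.card_eq_fintype_card, hF, sq]
    · simp [hmem]
    · simp [sigma15Matrix_eq_zero]
    · intro p c hc
      simp [smul_sigma15Matrix, rank_sigma15Matrix, hc]
    · rintro ⟨x, y⟩ ⟨x', y'⟩ c hxy
      rw [smul_sigma15Matrix, sigma15Matrix_inj] at hxy
      obtain ⟨hx, hy, hc⟩ := hxy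
      rw [mul_one] at hc
      simpa [← hc] using And.intro hx hy
    · intro M hM _ hrank
      obtain ⟨x, y, z, rfl⟩ := hcoord M hM
      have hz : z ≠ 0 := by
        rintro rfl
        rw [rank_sigma15Matrix] at hrank
        split_ifs at hrank <;> simp_all
      exact ⟨(z⁻¹ * x, z⁻¹ * y), z, by simp [smul_sigma15Matrix, hz]⟩
end

section
/- Let F be the field with 2 elements and let G be the group of all F-linear bijections g : Sym₃(F) → Sym₃(F) that map the set of rank-1 matrices onto itself (G is the full setwise stabilizer of the Veronese surface V(F₂) in PGL(6,2), a group isomorphic to Sym₇). Then the number of G-orbits of 3-dimensional F-linear subspaces of Sym₃(F) that contain at least one rank-1 matrix is exactly 5. -/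
open Matrix

/-- The space `Sym₃(F)` of symmetric `3×3` matrices over `F`, as a submodule of the space of
all `3×3` matrices. -/
def sym3 (F : Type) [Field F] : Submodule F (Matrix (Fin 3) (Fin 3) F) where
  carrier := {M | M.IsSymm}
  add_mem' := fun {a b} ha hb => by
    simp only [Set.mem_setOf_eq, Matrix.IsSymm, transpose_add] at *
    rw [ha, hb]
  zero_mem' := by simp [Matrix.IsSymm]
  smul_mem' := fun c M hM => by
    simp only [Set.mem_setOf_eq, Matrix.IsSymm, transpose_smul] at *
    rw [hM]

/-- A family of seven vectors of `V` is a *frame* if it spans `V` and its only linear relations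
are the multiples of `∑ i, M i = 0`. -/
structure IsFrame (F : Type*) {V : Type*} [Field F] [AddCommGroup V] [Module F V]
    (M : Fin 7 → V) : Prop where
  surjective : Function.Surjective (Fintype.linearCombination F M)
  sum_eq_zero_iff : ∀ w, Fintype.linearCombination F M w = 0 ↔ ∀ i j, w i = w j

/-- Two subspaces are frame-equivalent if a linear automorphism preserving the set of frame
vectors maps the first one onto the second one. -/
def FrameEquivalent {F V : Type*} [Field F] [AddCommGroup V] [Module F V]
    (M : Fin 7 → V) (W₁ W₂ : Submodule F V) : Prop :=
  ∃ g : V ≃ₗ[F] V, ⇑g '' Set.range M = Set.range M ∧ (W₂ : Set V) = ⇑g '' (W₁ : Set V)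

/-- The functions on `Option (Fin 4)` whose values on the four points `some k` sum to zero. Over
the field with two elements, their restrictions to the four points are the affine functions on
the affine plane of order two. -/
def affineWords (F : Type*) [Field F] : Submodule F (Option (Fin 4) → F) :=
  LinearMap.ker (∑ k : Fin 4, LinearMap.proj (R := F) (φ := fun _ : Option (Fin 4) => F) (some k))

/-- The subspace consisting of the combinations `∑ i, h (c i) • M i` with `h` in `affineWords`. -/
def planeOf (F : Type*) {V : Type*} [Field F] [AddCommGroup V] [Module F V]
    (M : Fin 7 → V) (c : Fin 7 → Option (Fin 4)) : Submodule F V :=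
  (affineWords F).map (Fintype.linearCombination F M ∘ₗ LinearMap.funLeft F F c)

/-- A colouring of the seven frame vectors by `none` and the points `some k`, where `none` is used
exactly once. -/
def IsColouring (c : Fin 7 → Option (Fin 4)) : Prop := ∃! i, c i = none

/-- The partitions of six into three or four parts, padded with zeros. -/
def stdPartition : Fin 5 → Fin 4 → ℕ :=
  ![![0, 1, 1, 4], ![0, 1, 2, 3], ![0, 2, 2, 2], ![1, 1, 1, 3], ![1, 1, 2, 2]]

/-- Colourings whose colour classes realise the partitions in `stdPartition`. -/
def stdColouring : Fin 5 → Fin 7 → Option (Fin 4) :=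
  ![![none, some 1, some 2, some 3, some 3, some 3, some 3],
    ![none, some 1, some 2, some 2, some 3, some 3, some 3],
    ![none, some 1, some 1, some 2, some 2, some 3, some 3],
    ![none, some 0, some 1, some 2, some 3, some 3, some 3],
    ![none, some 0, some 1, some 2, some 2, some 3, some 3]]

/-- Two frame indices are indistinguishable for `W` if every word that represents a vector of `W`
takes equal values at them. -/
def Indistinguishable {F V : Type*} [Field F] [AddCommGroup V] [Module F V]
    (M : Fin 7 → V) (W : Submodule F V) (i j : Fin 7) : Prop :=
  ∀ w, Fintype.linearCombination F M w ∈ W → w i = w j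

/-- The number of triples of mutually indistinguishable frame indices. -/
noncomputable def tripleCount {F V : Type*} [Field F] [AddCommGroup V] [Module F V]
    (M : Fin 7 → V) (W : Submodule F V) : ℕ :=
  Nat.card {t : Fin 7 × Fin 7 × Fin 7 //
    Indistinguishable M W t.1 t.2.1 ∧ Indistinguishable M W t.1 t.2.2}

/-! ### Colourings -/

/-- The number of frame vectors of colour `some k`. -/
def colourCount (c : Fin 7 → Option (Fin 4)) (k : Fin 4) : ℕ :=
  Fintype.card {i // c i = some k}

theorem isColouring_stdColouring (k : Fin 5) : IsColouring (stdColouring k) := by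
  refine ⟨0, ?_, ?_⟩ <;> revert k <;> decide

theorem exists_stdColouring_eq (k : Fin 5) (l : Fin 4) (hl : l ≠ 0) :
    ∃ i, stdColouring k i = some l := by
  revert k l; decide

theorem card_none_eq_one {c : Fin 7 → Option (Fin 4)} (hc : IsColouring c) :
    Fintype.card {i // c i = none} = 1 :=
  Fintype.card_eq_one_iff_nonempty_unique.2 ((unique_subtype_iff_existsUnique _).2 hc)

theorem sum_colourCount {c : Fin 7 → Option (Fin 4)} (hc : IsColouring c) :
    ∑ k, colourCount c k = 6 := by
  have h : Fintype.card (Fin 7) = ∑ k, Fintype.card {i // c i = k} := by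
    rw [← Fintype.card_sigma]
    exact Fintype.card_congr (Equiv.sigmaFiberEquiv c).symm
  rw [Fintype.card_fin, Fintype.sum_option, card_none_eq_one hc] at h
  simp only [colourCount]
  omega

theorem exists_perm_of_colourCount_eq {c d : Fin 7 → Option (Fin 4)} (hc : IsColouring c)
    (hd : IsColouring d) (h : ∀ k, colourCount c k = colourCount d k) :
    ∃ σ : Equiv.Perm (Fin 7), ∀ i, d (σ i) = c i := by
  have key (k : Option (Fin 4)) : Nonempty ({i // c i = k} ≃ {i // d i = k}) := by
    refine Fintype.card_eq.1 ?_
    cases k with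
    | none => rw [card_none_eq_one hc, card_none_eq_one hd]
    | some k => exact h k
  exact ⟨Equiv.ofFiberEquiv fun k => (key k).some, Equiv.ofFiberEquiv_map _⟩

theorem colourCount_map (τ : Equiv.Perm (Fin 4)) (c : Fin 7 → Option (Fin 4)) (k : Fin 4) :
    colourCount (fun i => (c i).map τ) k = colourCount c (τ.symm k) := by
  refine Fintype.card_congr (Equiv.subtypeEquivRight fun i => ?_)
  rw [Option.map_eq_some_iff]
  exact ⟨fun ⟨a, ha, hk⟩ => by rw [ha, ← hk, τ.symm_apply_apply],
    fun h => ⟨_, h, τ.apply_symm_apply k⟩⟩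

theorem IsColouring.map {c : Fin 7 → Option (Fin 4)} (hc : IsColouring c)
    (τ : Equiv.Perm (Fin 4)) : IsColouring fun i => (c i).map τ := by
  simpa [IsColouring] using hc

theorem exists_monotone_colourCount (c : Fin 7 → Option (Fin 4)) :
    ∃ τ : Equiv.Perm (Fin 4), Monotone (colourCount fun i => (c i).map τ) := by
  refine ⟨(Tuple.sort (colourCount c)).symm, ?_⟩
  intro k l hkl
  rw [colourCount_map, colourCount_map, Equiv.symm_symm]
  exact Tuple.monotone_sort (colourCount c) hkl

theorem exists_partition_of_monotone {n : Fin 4 → ℕ} (hn : Monotone n) (hsum : ∑ k, n k = 6)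
    (h1 : n 1 ≠ 0) : ∃ k, n = stdPartition k := by
  rw [Fin.sum_univ_four] at hsum
  have h01 : n 0 ≤ n 1 := hn (by decide)
  have h12 : n 1 ≤ n 2 := hn (by decide)
  have h23 : n 2 ≤ n 3 := hn (by decide)
  have hn4 : n = ![n 0, n 1, n 2, n 3] := by
    ext i
    fin_cases i <;> rfl
  obtain ⟨e0, e1, e2, e3⟩ | ⟨e0, e1, e2, e3⟩ | ⟨e0, e1, e2, e3⟩ | ⟨e0, e1, e2, e3⟩ |
      ⟨e0, e1, e2, e3⟩ : (n 0 = 0 ∧ n 1 = 1 ∧ n 2 = 1 ∧ n 3 = 4) ∨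
      (n 0 = 0 ∧ n 1 = 1 ∧ n 2 = 2 ∧ n 3 = 3) ∨ (n 0 = 0 ∧ n 1 = 2 ∧ n 2 = 2 ∧ n 3 = 2) ∨
      (n 0 = 1 ∧ n 1 = 1 ∧ n 2 = 1 ∧ n 3 = 3) ∨ (n 0 = 1 ∧ n 1 = 1 ∧ n 2 = 2 ∧ n 3 = 2) := by
    omega
  all_goals rw [hn4, e0, e1, e2, e3]
  exacts [⟨0, rfl⟩, ⟨1, rfl⟩, ⟨2, rfl⟩, ⟨3, rfl⟩, ⟨4, rfl⟩]

theorem colourCount_stdColouring (k : Fin 5) (l : Fin 4) :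
    colourCount (stdColouring k) l = stdPartition k l := by
  rw [colourCount, Fintype.card_subtype]
  revert k l
  decide +kernel

theorem exists_stdColouring_of_monotone {c : Fin 7 → Option (Fin 4)} (hc : IsColouring c)
    (hmono : Monotone (colourCount c)) (h1 : colourCount c 1 ≠ 0) :
    ∃ (k : Fin 5) (σ : Equiv.Perm (Fin 7)), ∀ i, stdColouring k (σ i) = c i := by
  obtain ⟨k, hk⟩ := exists_partition_of_monotone hmono (sum_colourCount hc) h1
  exact ⟨k, exists_perm_of_colourCount_eq hc (isColouring_stdColouring k) fun l => by
    rw [hk, colourCount_stdColouring]⟩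

theorem eq_of_card_monochromatic_triples_eq {k l : Fin 5}
    (h : Fintype.card {t : Fin 7 × Fin 7 × Fin 7 // stdColouring k t.1 = stdColouring k t.2.1 ∧
        stdColouring k t.1 = stdColouring k t.2.2} =
      Fintype.card {t : Fin 7 × Fin 7 × Fin 7 // stdColouring l t.1 = stdColouring l t.2.1 ∧
        stdColouring l t.1 = stdColouring l t.2.2}) : k = l := by
  have std (k : Fin 5) : Fintype.card {t : Fin 7 × Fin 7 × Fin 7 //
      stdColouring k t.1 = stdColouring k t.2.1 ∧ stdColouring k t.1 = stdColouring k t.2.2} =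
      (![67, 37, 25, 31, 19] : Fin 5 → ℕ) k := by
    rw [Fintype.card_subtype]
    revert k
    decide +kernel
  rw [std, std] at h
  revert k l
  decide

section Frame

variable {F V : Type*} [Field F] [AddCommGroup V] [Module F V] {M : Fin 7 → V}

/-! ### Frame-preserving automorphisms -/

theorem IsFrame.injective (hM : IsFrame F M) : Function.Injective M := by
  intro i j hij
  by_contra hne
  have h := (hM.sum_eq_zero_iff (Pi.single i 1 - Pi.single j 1)).1
    (by simp [map_sub, Fintype.linearCombination_apply_single, hij])
  obtain ⟨k, hki, hkj⟩ : ∃ k, k ≠ i ∧ k ≠ j := by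
    clear h hij
    revert i j
    decide
  simpa [hne, hki, hkj] using h i k

theorem IsFrame.exists_equiv (hM : IsFrame F M) (σ : Equiv.Perm (Fin 7)) :
    ∃ g : V ≃ₗ[F] V, ∀ i, g (M i) = M (σ i) := by
  have hker : (LinearMap.ker (Fintype.linearCombination F M)).map
      (LinearEquiv.funCongrLeft F F σ.symm : (Fin 7 → F) →ₗ[F] Fin 7 → F) =
      LinearMap.ker (Fintype.linearCombination F M) := by
    ext w
    rw [Submodule.mem_map_equiv, LinearMap.mem_ker, LinearMap.mem_ker, hM.sum_eq_zero_iff,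
      hM.sum_eq_zero_iff]
    simp only [LinearEquiv.funCongrLeft_symm, LinearEquiv.funCongrLeft_apply,
      LinearMap.funLeft_apply, Equiv.symm_symm]
    exact ⟨fun h i j => by simpa using h (σ.symm i) (σ.symm j), fun h i j => h _ _⟩
  let e := (Fintype.linearCombination F M).quotKerEquivOfSurjective hM.surjective
  refine ⟨e.symm.trans ((Submodule.Quotient.equiv _ _ _ hker).trans e), fun i => ?_⟩
  have he (i : Fin 7) : e (Submodule.Quotient.mk (Pi.single i 1)) = M i := by
    simp [e, Fintype.linearCombination_apply_single]
  rw [LinearEquiv.trans_apply, LinearEquiv.trans_apply, ← he i, e.symm_apply_apply,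
    Submodule.Quotient.equiv_apply, Submodule.mapQ_apply, ← he]
  congr 2
  ext j
  simp [LinearMap.funLeft_apply, Pi.single_apply, Equiv.symm_apply_eq]

theorem image_range_eq {g : V ≃ₗ[F] V} {σ : Equiv.Perm (Fin 7)} (h : ∀ i, g (M i) = M (σ i)) :
    ⇑g '' Set.range M = Set.range M := by
  rw [← Set.range_comp, show ⇑g ∘ M = M ∘ σ from funext h, σ.surjective.range_comp]

theorem IsFrame.exists_perm (hM : IsFrame F M) {g : V ≃ₗ[F] V}
    (hg : ⇑g '' Set.range M = Set.range M) :
    ∃ σ : Equiv.Perm (Fin 7), ∀ i, g (M i) = M (σ i) := by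
  have h (i : Fin 7) : ∃ j, M j = g (M i) := by
    have : g (M i) ∈ ⇑g '' Set.range M := ⟨_, ⟨i, rfl⟩, rfl⟩
    rwa [hg] at this
  choose s hs using h
  have hinj : Function.Injective s := fun i j hij => hM.injective <| g.injective <| by
    rw [← hs, ← hs, hij]
  exact ⟨Equiv.ofBijective s (Finite.injective_iff_bijective.1 hinj), fun i => (hs i).symm⟩

theorem apply_linearCombination {g : V ≃ₗ[F] V} {σ : Equiv.Perm (Fin 7)}
    (h : ∀ i, g (M i) = M (σ i)) (w : Fin 7 → F) :
    g (Fintype.linearCombination F M (w ∘ σ)) = Fintype.linearCombination F M w := by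
  simp only [Fintype.linearCombination_apply, map_sum, map_smul, h, Function.comp_apply]
  exact Equiv.sum_comp σ fun i => w i • M i

namespace FrameEquivalent

variable {W₁ W₂ W₃ : Submodule F V}

theorem symm (h : FrameEquivalent M W₁ W₂) : FrameEquivalent M W₂ W₁ := by
  obtain ⟨g, hg, hW⟩ := h
  refine ⟨g.symm, ?_, ?_⟩
  · conv_lhs => rw [← hg]
    exact g.toEquiv.symm_image_image _
  · rw [hW]
    exact (g.toEquiv.symm_image_image _).symm

theorem trans (h : FrameEquivalent M W₁ W₂) (h' : FrameEquivalent M W₂ W₃) :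
    FrameEquivalent M W₁ W₃ := by
  obtain ⟨g, hg, hW⟩ := h
  obtain ⟨g', hg', hW'⟩ := h'
  refine ⟨g.trans g', ?_, ?_⟩
  · rw [show ⇑(g.trans g') = ⇑g' ∘ ⇑g from rfl, Set.image_comp, hg, hg']
  · rw [hW', hW, ← Set.image_comp]
    rfl

theorem tripleCount_eq (h : FrameEquivalent M W₁ W₂) (hM : IsFrame F M) :
    tripleCount M W₁ = tripleCount M W₂ := by
  obtain ⟨g, hg, hW⟩ := h
  obtain ⟨σ, hσ⟩ := hM.exists_perm hg
  have key (i j : Fin 7) :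
      Indistinguishable M W₁ i j ↔ Indistinguishable M W₂ (σ i) (σ j) := by
    have hmem (w : Fin 7 → F) : Fintype.linearCombination F M w ∈ W₂ ↔
        Fintype.linearCombination F M (w ∘ σ) ∈ W₁ := by
      rw [← SetLike.mem_coe, hW, ← apply_linearCombination hσ w, g.injective.mem_set_image,
        SetLike.mem_coe]
    refine ⟨fun h w hw => h _ ((hmem w).1 hw), fun h w hw => ?_⟩
    have hw' : (w ∘ σ.symm) ∘ σ = w := by ext; simp
    simpa using h (w ∘ σ.symm) ((hmem _).2 (by rwa [hw']))
  refine Nat.card_congr (Equiv.subtypeEquiv (σ.prodCongr (σ.prodCongr σ)) fun t => ?_)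
  simp [key]

end FrameEquivalent

/-! ### The subspaces attached to colourings -/

theorem mem_affineWords {h : Option (Fin 4) → F} :
    h ∈ affineWords F ↔ ∑ k, h (some k) = 0 := by
  simp [affineWords]

theorem mem_planeOf {c : Fin 7 → Option (Fin 4)} {x : V} :
    x ∈ planeOf F M c ↔
      ∃ h ∈ affineWords F, Fintype.linearCombination F M (h ∘ c) = x :=
  Iff.rfl

theorem planeOf_map (τ : Equiv.Perm (Fin 4)) (c : Fin 7 → Option (Fin 4)) :
    planeOf F M (fun i => (c i).map τ) = planeOf F M c := by
  have le (τ : Equiv.Perm (Fin 4)) (c : Fin 7 → Option (Fin 4)) :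
      planeOf F M (fun i => (c i).map τ) ≤ planeOf F M c := by
    rintro x ⟨h, hh, rfl⟩
    refine ⟨h ∘ Option.map τ, mem_affineWords.2 ?_, rfl⟩
    simpa using (Equiv.sum_comp τ fun k => h (some k)).trans (mem_affineWords.1 hh)
  refine (le τ c).antisymm ?_
  simpa [Option.map_map, Function.comp_def] using le τ.symm fun i => (c i).map τ

theorem IsFrame.planeOf_equivalent (hM : IsFrame F M) {c d : Fin 7 → Option (Fin 4)}
    {σ : Equiv.Perm (Fin 7)} (h : ∀ i, d (σ i) = c i) :
    FrameEquivalent M (planeOf F M c) (planeOf F M d) := by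
  obtain ⟨g, hg⟩ := hM.exists_equiv σ
  refine ⟨g, image_range_eq hg, ?_⟩
  have hcd : c = d ∘ σ := funext fun i => (h i).symm
  ext x
  rw [SetLike.mem_coe, mem_planeOf]
  constructor
  · rintro ⟨f, hf, rfl⟩
    exact ⟨_, ⟨f, hf, rfl⟩, by rw [← apply_linearCombination hg (f ∘ d), hcd]; rfl⟩
  · rintro ⟨_, ⟨f, hf, rfl⟩, rfl⟩
    exact ⟨f, hf, by rw [← apply_linearCombination hg (f ∘ d), hcd]; rfl⟩

theorem frame_mem_planeOf {c : Fin 7 → Option (Fin 4)} (hc : IsColouring c) :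
    ∃ i, c i = none ∧ M i ∈ planeOf F M c := by
  obtain ⟨i, hi, huniq⟩ := hc
  refine ⟨i, hi, mem_planeOf.2 ⟨Pi.single none 1, mem_affineWords.2 (by simp), ?_⟩⟩
  have : (Pi.single none 1 : Option (Fin 4) → F) ∘ c = Pi.single i 1 := by
    ext j
    by_cases hj : j = i
    · simp [hj, hi]
    · have : c j ≠ none := fun h => hj (huniq j h)
      simp [hj, this]
  rw [this, Fintype.linearCombination_apply_single, one_smul]

theorem exists_eq_sup_span [FiniteDimensional F V] {W : Submodule F V}
    (hW : Module.finrank F W = 3) {m : V} (hm : m ∈ W) (hm0 : m ≠ 0) :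
    ∃ x y, W = (F ∙ m) ⊔ (F ∙ x) ⊔ (F ∙ y) := by
  have extend (U : Submodule F V) (hU : U ≤ W) (hlt : Module.finrank F U < 3) :
      ∃ x, U ⊔ (F ∙ x) ≤ W ∧ Module.finrank F U < Module.finrank F ↥(U ⊔ (F ∙ x)) := by
    obtain ⟨x, hxW, hxU⟩ := SetLike.exists_of_lt (lt_of_le_of_ne hU (by
      rintro rfl
      exact hlt.ne hW))
    have hx : F ∙ x ≤ W := by simpa using hxW
    refine ⟨x, sup_le hU hx, Submodule.finrank_lt_finrank_of_lt (left_lt_sup.2 ?_)⟩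
    simpa using hxU
  have h1 := finrank_span_singleton (K := F) hm0
  obtain ⟨x, hxW, hx⟩ := extend (F ∙ m) (by simpa using hm) (by omega)
  have h2 := Submodule.finrank_add_le_finrank_add_finrank (F ∙ m) (F ∙ x)
  have h3 : Module.finrank F (F ∙ x) ≤ 1 := by
    simpa using finrank_span_le_card (R := F) ({x} : Set V)
  obtain ⟨y, hyW, hy⟩ := extend _ hxW (by omega)
  exact ⟨x, y, (Submodule.eq_of_le_of_finrank_le hyW (by omega)).symm⟩

variable [CharP F 2]

/-- The function in `affineWords` that vanishes at `some 3` and has the given values at `none`,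
`some 1` and `some 2`. -/
def wordOf (F : Type*) [Field F] : (Fin 3 → F) →ₗ[F] Option (Fin 4) → F where
  toFun a k := k.elim (a 0) ![a 1 + a 2, a 1, a 2, 0]
  map_add' a b := by
    ext k
    rcases k with _ | k
    · rfl
    · fin_cases k <;> simp [add_add_add_comm]
  map_smul' r a := by
    ext k
    rcases k with _ | k
    · rfl
    · fin_cases k <;> simp [mul_add]

theorem wordOf_mem (a : Fin 3 → F) : wordOf F a ∈ affineWords F := by
  rw [mem_affineWords, Fin.sum_univ_four]
  change a 1 + a 2 + a 1 + a 2 + 0 = 0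
  linear_combination (a 1 + a 2) * CharTwo.two_eq_zero (R := F)

theorem exists_wordOf {h : Option (Fin 4) → F} (hh : h ∈ affineWords F) :
    ∃ a, wordOf F a = fun k => h k - h (some 3) := by
  rw [mem_affineWords, Fin.sum_univ_four] at hh
  have h2 := CharTwo.two_eq_zero (R := F)
  refine ⟨![h none - h (some 3), h (some 1) - h (some 3), h (some 2) - h (some 3)], ?_⟩
  ext k
  rcases k with _ | k
  · rfl
  fin_cases k
  · change h (some 1) - h (some 3) + (h (some 2) - h (some 3)) = h (some 0) - h (some 3)
    linear_combination (h (some 1) + h (some 2)) * h2 - hh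
  · rfl
  · rfl
  · exact (sub_self _).symm

theorem IsFrame.planeOf_eq_range (hM : IsFrame F M) (c : Fin 7 → Option (Fin 4)) :
    planeOf F M c = LinearMap.range
      (Fintype.linearCombination F M ∘ₗ LinearMap.funLeft F F c ∘ₗ wordOf F) := by
  ext x
  constructor
  · rintro ⟨h, hh, rfl⟩
    obtain ⟨a, ha⟩ := exists_wordOf hh
    refine ⟨a, ?_⟩
    simp only [LinearMap.comp_apply, ha]
    rw [← sub_eq_zero, ← map_sub, hM.sum_eq_zero_iff]
    simp [LinearMap.funLeft_apply]
  · rintro ⟨a, rfl⟩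
    exact ⟨_, wordOf_mem a, rfl⟩

theorem IsFrame.finrank_planeOf_le (hM : IsFrame F M) (c : Fin 7 → Option (Fin 4)) :
    Module.finrank F (planeOf F M c) ≤ 3 := by
  rw [hM.planeOf_eq_range]
  simpa using LinearMap.finrank_range_le
    (Fintype.linearCombination F M ∘ₗ LinearMap.funLeft F F c ∘ₗ wordOf F)

theorem IsFrame.finrank_planeOf (hM : IsFrame F M) {c : Fin 7 → Option (Fin 4)}
    (hc : IsColouring c) (hsurj : ∀ l ≠ 0, ∃ i, c i = some l) :
    Module.finrank F (planeOf F M c) = 3 := by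
  rw [hM.planeOf_eq_range, LinearMap.finrank_range_of_inj, Module.finrank_fin_fun]
  rw [injective_iff_map_eq_zero]
  intro a ha
  have hconst := (hM.sum_eq_zero_iff _).1 ha
  obtain ⟨i₀, h₀, -⟩ := hc
  obtain ⟨i₁, h₁⟩ := hsurj 1 (by decide)
  obtain ⟨i₂, h₂⟩ := hsurj 2 (by decide)
  obtain ⟨i₃, h₃⟩ := hsurj 3 (by decide)
  have e₀ := hconst i₀ i₃
  have e₁ := hconst i₁ i₃
  have e₂ := hconst i₂ i₃
  simp [LinearMap.funLeft_apply, wordOf, h₀, h₁, h₂, h₃] at e₀ e₁ e₂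
  ext j
  fin_cases j <;> assumption

theorem IsFrame.colourCount_one_ne_zero (hM : IsFrame F M) {c : Fin 7 → Option (Fin 4)}
    (hmono : Monotone (colourCount c)) (hdim : Module.finrank F (planeOf F M c) = 3) :
    colourCount c 1 ≠ 0 := by
  intro h1
  have h0 : colourCount c 0 = 0 := Nat.le_zero.1 (h1 ▸ hmono (by decide))
  rw [colourCount, Fintype.card_eq_zero_iff, isEmpty_subtype] at h0 h1
  rw [hM.planeOf_eq_range] at hdim
  have hrank := LinearMap.finrank_range_add_finrank_ker
    (Fintype.linearCombination F M ∘ₗ LinearMap.funLeft F F c ∘ₗ wordOf F)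
  rw [hdim, Module.finrank_fin_fun] at hrank
  have hker := Submodule.finrank_eq_zero.1 (Nat.add_left_cancel hrank)
  have hword : LinearMap.funLeft F F c (wordOf F (Pi.single 1 1)) = 0 := by
    ext i
    rw [LinearMap.funLeft_apply]
    rcases hi : c i with _ | k
    · rfl
    fin_cases k
    · exact absurd hi (h0 i)
    · exact absurd hi (h1 i)
    · rfl
    · rfl
  have : (Pi.single 1 1 : Fin 3 → F) = 0 := by
    rw [← Submodule.mem_bot F, ← hker, LinearMap.mem_ker, LinearMap.comp_apply,
      LinearMap.comp_apply, hword, map_zero]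
  simpa using congrFun this 1

theorem IsFrame.indistinguishable_planeOf (hM : IsFrame F M) (c : Fin 7 → Option (Fin 4))
    (i j : Fin 7) : Indistinguishable M (planeOf F M c) i j ↔ c i = c j := by
  constructor
  · intro H
    have sep (h : Option (Fin 4) → F) (hh : h ∈ affineWords F) : h (c i) = h (c j) :=
      H (h ∘ c) (mem_planeOf.2 ⟨h, hh, rfl⟩)
    have hnone := sep (Pi.single none 1) (mem_affineWords.2 (by simp))
    rcases hi : c i with _ | a <;> rcases hj : c j with _ | b
    · rfl
    · simp [hi, hj] at hnone
    · simp [hi, hj] at hnone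
    · by_contra hab
      replace hab : a ≠ b := fun h => hab (congrArg some h)
      obtain ⟨d, hda, hdb⟩ : ∃ d, d ≠ a ∧ d ≠ b := by
        clear hi hj; revert a b; decide
      have := sep (Pi.single (some a) 1 + Pi.single (some d) 1) (mem_affineWords.2 (by
        simp [Finset.sum_add_distrib, Pi.single_apply, CharTwo.add_self_eq_zero]))
      simp [hi, hj, hab.symm, hda.symm, hdb.symm] at this
  · rintro hij w ⟨h, -, hw⟩
    have := (hM.sum_eq_zero_iff (w - h ∘ c)).1 (by
      rw [map_sub, ← hw]
      exact sub_self _) i j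
    simpa [hij] using this

theorem IsFrame.eq_of_frameEquivalent (hM : IsFrame F M) {k l : Fin 5}
    (h : FrameEquivalent M (planeOf F M (stdColouring k)) (planeOf F M (stdColouring l))) :
    k = l := by
  have := h.tripleCount_eq hM
  simp only [tripleCount, hM.indistinguishable_planeOf, Nat.card_eq_fintype_card] at this
  exact eq_of_card_monochromatic_triples_eq this

/-! ### Classification -/

theorem IsFrame.exists_planeOf_eq (hM : IsFrame F M) (hF : ∀ a : F, a = 0 ∨ a = 1)
    {W : Submodule F V} (hW : Module.finrank F W = 3) (hMW : ∃ m ∈ W, m ∈ Set.range M) :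
    ∃ c, IsColouring c ∧ planeOf F M c = W := by
  obtain ⟨_, hmW, i₀, rfl⟩ := hMW
  have hm0 : M i₀ ≠ 0 := fun h => by
    have h' := (hM.sum_eq_zero_iff (Pi.single i₀ 1)).1
      (by rw [Fintype.linearCombination_apply_single, h, smul_zero])
    obtain ⟨j, hj⟩ := exists_ne i₀
    simpa [hj] using h' i₀ j
  have : FiniteDimensional F V := Module.Finite.of_surjective _ hM.surjective
  obtain ⟨X, Y, rfl⟩ := exists_eq_sup_span hW hmW hm0
  obtain ⟨x, rfl⟩ := hM.surjective X
  obtain ⟨y, rfl⟩ := hM.surjective Y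
  have hp (a b : F) : ∃ k : Fin 4, ![0, 1, 0, 1] k = a ∧ ![0, 0, 1, 1] k = b := by
    rcases hF a with rfl | rfl <;> rcases hF b with rfl | rfl
    exacts [⟨0, rfl, rfl⟩, ⟨2, rfl, rfl⟩, ⟨1, rfl, rfl⟩, ⟨3, rfl, rfl⟩]
  choose p hpx hpy using hp
  let c : Fin 7 → Option (Fin 4) := fun i => if i = i₀ then none else some (p (x i) (y i))
  have hc : IsColouring c := ⟨i₀, by simp [c], fun j hj => by simpa [c] using hj⟩
  have mem (q : Fin 4 → F) (hq : ∑ k, q k = 0) (w : Fin 7 → F)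
      (hw : ∀ i, q (p (x i) (y i)) = w i) :
      Fintype.linearCombination F M w ∈ planeOf F M c := by
    refine mem_planeOf.2 ⟨fun k => k.elim (w i₀) q, mem_affineWords.2 hq, congrArg _ ?_⟩
    ext i
    by_cases hi : i = i₀ <;> simp [c, hi, hw]
  refine ⟨c, hc, (Submodule.eq_of_le_of_finrank_le ?_ ?_).symm⟩
  · simp only [sup_le_iff, Submodule.span_singleton_le_iff_mem]
    refine ⟨⟨?_, mem _ ?_ x fun i => hpx _ _⟩, mem _ ?_ y fun i => hpy _ _⟩
    · obtain ⟨i, hi, hMi⟩ := frame_mem_planeOf (F := F) (M := M) hc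
      have : i = i₀ := by simpa [c] using hi
      exact this ▸ hMi
    · simp [Fin.sum_univ_four, CharTwo.add_self_eq_zero]
    · simp [Fin.sum_univ_four, CharTwo.add_self_eq_zero]
  · exact (hM.finrank_planeOf_le c).trans hW.ge

theorem IsFrame.exists_equivalent_std (hM : IsFrame F M) (hF : ∀ a : F, a = 0 ∨ a = 1)
    {W : Submodule F V} (hW : Module.finrank F W = 3) (hMW : ∃ m ∈ W, m ∈ Set.range M) :
    ∃ k, FrameEquivalent M W (planeOf F M (stdColouring k)) := by
  obtain ⟨c, hc, rfl⟩ := hM.exists_planeOf_eq hF hW hMW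
  obtain ⟨τ, hτ⟩ := exists_monotone_colourCount c
  rw [← planeOf_map τ c] at hW ⊢
  obtain ⟨k, σ, hσ⟩ := exists_stdColouring_of_monotone (hc.map τ) hτ
    (hM.colourCount_one_ne_zero hτ hW)
  exact ⟨k, hM.planeOf_equivalent hσ⟩

theorem IsFrame.exists_orbit_map (hM : IsFrame F M) (hF : ∀ a : F, a = 0 ∨ a = 1)
    {P : V → Prop} (hP : ∀ m, P m ↔ m ∈ Set.range M) :
    ∃ f : {W : Submodule F V // Module.finrank F W = 3 ∧ ∃ m ∈ W, P m} → Fin 5,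
      Function.Surjective f ∧
      ∀ W₁ W₂, (f W₁ = f W₂ ↔ ∃ g : V ≃ₗ[F] V, ⇑g '' {m | P m} = {m | P m} ∧
        (W₂.val : Set V) = ⇑g '' (W₁.val : Set V)) := by
  obtain rfl : P = fun m => m ∈ Set.range M := funext fun m => propext (hP m)
  choose f hf using fun W : {W : Submodule F V // Module.finrank F W = 3 ∧
    ∃ m ∈ W, m ∈ Set.range M} => hM.exists_equivalent_std hF W.2.1 W.2.2
  suffices h : Function.Surjective f ∧
      ∀ W₁ W₂, f W₁ = f W₂ ↔ FrameEquivalent M W₁.val W₂.val from ⟨f, h⟩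
  refine ⟨fun k => ?_, fun W₁ W₂ => ⟨fun h => ?_, fun h => ?_⟩⟩
  · have hk := isColouring_stdColouring k
    obtain ⟨i, -, hi⟩ := frame_mem_planeOf (F := F) (M := M) hk
    exact ⟨⟨planeOf F M (stdColouring k), hM.finrank_planeOf hk (exists_stdColouring_eq k),
      M i, hi, i, rfl⟩, (hM.eq_of_frameEquivalent (hf _)).symm⟩
  · exact (hf W₁).trans (h ▸ (hf W₂).symm)
  · exact hM.eq_of_frameEquivalent (((hf W₁).symm.trans h).trans (hf W₂))

end Frame

/-! ### The Veronese frame -/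

/-- Representatives of the seven points of the projective plane of order two. -/
def fanoPoint (F : Type) [Field F] : Fin 7 → Fin 3 → F :=
  ![![1, 0, 0], ![0, 1, 0], ![0, 0, 1], ![1, 1, 0], ![1, 0, 1], ![0, 1, 1], ![1, 1, 1]]

/-- The rank-one matrices attached to the seven points of the projective plane of order two. -/
def veronese (F : Type) [Field F] (i : Fin 7) : sym3 F :=
  ⟨vecMulVec (fanoPoint F i) (fanoPoint F i), transpose_vecMulVec _ _⟩

theorem linearCombination_veronese {F : Type} [Field F] (w : Fin 7 → F) :
    (Fintype.linearCombination F (veronese F) w : Matrix (Fin 3) (Fin 3) F) =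
      !![w 0 + w 3 + w 4 + w 6, w 3 + w 6, w 4 + w 6;
        w 3 + w 6, w 1 + w 3 + w 5 + w 6, w 5 + w 6;
        w 4 + w 6, w 5 + w 6, w 2 + w 4 + w 5 + w 6] := by
  ext i j
  fin_cases i <;> fin_cases j <;>
    simp [Fintype.linearCombination_apply, Fin.sum_univ_succ, veronese, fanoPoint,
      ] <;> ring

theorem isFrame_veronese (F : Type) [Field F] [CharP F 2] : IsFrame F (veronese F) where
  surjective A := by
    obtain ⟨A, hA⟩ := A
    refine ⟨![A 0 0 - A 0 1 - A 0 2, A 1 1 - A 0 1 - A 1 2, A 2 2 - A 0 2 - A 1 2,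
      A 0 1, A 0 2, A 1 2, 0], Subtype.ext ?_⟩
    rw [linearCombination_veronese]
    ext i j
    fin_cases i <;> fin_cases j <;> simp [hA.apply 0 1, hA.apply 0 2, hA.apply 1 2] <;>
      ring
  sum_eq_zero_iff w := by
    rw [← Submodule.coe_eq_zero, linearCombination_veronese]
    have h2 := CharTwo.two_eq_zero (R := F)
    constructor
    · intro h
      have e (i j : Fin 3) := congrFun (congrFun h i) j
      have e₀ := e 0 0
      have e₁ := e 1 1
      have e₂ := e 2 2
      have e₃ := e 0 1
      have e₄ := e 0 2
      have e₅ := e 1 2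
      simp at e₀ e₁ e₂ e₃ e₄ e₅
      have key (i : Fin 7) : w i = w 6 := by
        fin_cases i <;> dsimp
        · linear_combination e₀ - e₃ - e₄
        · linear_combination e₁ - e₃ - e₅
        · linear_combination e₂ - e₄ - e₅
        · linear_combination e₃ - w 6 * h2
        · linear_combination e₄ - w 6 * h2
        · linear_combination e₅ - w 6 * h2
      intro i j
      rw [key i, key j]
    · intro h
      ext i j
      fin_cases i <;> fin_cases j <;>
        simp [h _ 6, CharTwo.add_self_eq_zero]

theorem rank_vecMulVec_self {F : Type} [Field F] {v : Fin 3 → F} (hv : v ≠ 0) :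
    (vecMulVec v v).rank = 1 := by
  refine (rank_vecMulVec_le v v).antisymm (Nat.one_le_iff_ne_zero.2 fun h => hv ?_)
  rw [Matrix.rank, Submodule.finrank_eq_zero, LinearMap.range_eq_bot] at h
  ext i
  have := congrFun (LinearMap.congr_fun h (Pi.single i 1)) i
  simpa [vecMulVec_apply] using this

theorem exists_eq_vecMulVec_self {F : Type} [Field F] (hF : ∀ a : F, a = 0 ∨ a = 1)
    {A : Matrix (Fin 3) (Fin 3) F} (hA : A.IsSymm) (hrank : A.rank = 1) :
    ∃ v ≠ 0, A = vecMulVec v v := by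
  have hspan := hrank
  rw [rank_eq_finrank_span_cols, finrank_eq_one_iff'] at hspan
  obtain ⟨⟨v, _⟩, hv, hcol⟩ := hspan
  have hv0 : v ≠ 0 := fun h => hv (Subtype.ext h)
  have hcol' (j : Fin 3) : ∃ a, ∀ i, A i j = a * v i := by
    obtain ⟨a, ha⟩ := hcol ⟨A.col j, Submodule.subset_span ⟨j, rfl⟩⟩
    exact ⟨a, fun i => (congrFun (congrArg Subtype.val ha) i).symm⟩
  choose w hw using hcol'
  obtain ⟨k, hk⟩ := Function.ne_iff.1 hv0
  have hk1 : v k = 1 := (hF _).resolve_left hk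
  have hwv (j : Fin 3) : w j = w k * v j := by
    rw [← hw, ← hA.apply, hw, hk1, mul_one]
  rcases hF (w k) with h0 | h1
  · have : A = 0 := by
      ext i j
      rw [hw, hwv, h0, zero_mul, zero_mul, Matrix.zero_apply]
    simp [this] at hrank
  · refine ⟨v, hv0, ?_⟩
    ext i j
    rw [hw, hwv, h1, one_mul, vecMulVec_apply, mul_comm]

theorem exists_fanoPoint_eq {F : Type} [Field F] (hF : ∀ a : F, a = 0 ∨ a = 1)
    {v : Fin 3 → F} (hv : v ≠ 0) : ∃ i, fanoPoint F i = v := by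
  have hv3 : v = ![v 0, v 1, v 2] := by
    ext i
    fin_cases i <;> rfl
  rw [hv3] at hv ⊢
  rcases hF (v 0) with h0 | h0 <;> rcases hF (v 1) with h1 | h1 <;>
    rcases hF (v 2) with h2 | h2 <;> rw [h0, h1, h2] at hv ⊢
  · simp at hv
  exacts [⟨2, rfl⟩, ⟨1, rfl⟩, ⟨5, rfl⟩, ⟨0, rfl⟩, ⟨4, rfl⟩, ⟨3, rfl⟩, ⟨6, rfl⟩]

theorem fanoPoint_ne_zero {F : Type} [Field F] (i : Fin 7) : fanoPoint F i ≠ 0 := by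
  fin_cases i <;> simp [fanoPoint]

theorem rank_eq_one_iff_mem_range_veronese {F : Type} [Field F] (hF : ∀ a : F, a = 0 ∨ a = 1)
    (A : sym3 F) : (A : Matrix (Fin 3) (Fin 3) F).rank = 1 ↔ A ∈ Set.range (veronese F) := by
  constructor
  · intro h
    obtain ⟨v, hv, hA⟩ := exists_eq_vecMulVec_self hF A.2 h
    obtain ⟨i, rfl⟩ := exists_fanoPoint_eq hF hv
    exact ⟨i, Subtype.ext hA.symm⟩
  · rintro ⟨i, rfl⟩
    exact rank_vecMulVec_self (fanoPoint_ne_zero i)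

/-- Over `F₂`, the full setwise stabiliser of the Veronese surface (the group of linear
bijections of `Sym₃(F₂)` preserving the set of rank-1 matrices, isomorphic to `Sym₇`) has
exactly `5` orbits on the 3-dimensional subspaces of `Sym₃(F₂)` containing a rank-1 matrix. -/
theorem five_orbits_of_planes_over_F2
    (F : Type) [Field F] [Fintype F] (hF : Fintype.card F = 2) :
    ∃ f : {W : Submodule F ↥(sym3 F) // Module.finrank F ↥W = 3 ∧
        ∃ M ∈ W, Matrix.rank (M : Matrix (Fin 3) (Fin 3) F) = 1} → Fin 5,
      Function.Surjective f ∧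
      ∀ W₁ W₂, (f W₁ = f W₂ ↔
        ∃ g : ↥(sym3 F) ≃ₗ[F] ↥(sym3 F),
          (⇑g '' {M : ↥(sym3 F) | Matrix.rank (M : Matrix (Fin 3) (Fin 3) F) = 1} =
            {M : ↥(sym3 F) | Matrix.rank (M : Matrix (Fin 3) (Fin 3) F) = 1}) ∧
          (W₂.val : Set ↥(sym3 F)) = ⇑g '' (W₁.val : Set ↥(sym3 F))) := by
  have : Fact (Nat.Prime 2) := ⟨Nat.prime_two⟩
  have : CharP F 2 := charP_of_card_eq_prime hF
  have h01 (a : F) : a = 0 ∨ a = 1 := by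
    classical
    obtain ⟨b, c, -, hbc⟩ := Finset.card_eq_two.1 (Finset.card_univ.trans hF)
    have h (a : F) : a = b ∨ a = c := by
      simpa [hbc] using Finset.mem_univ a
    have := h 0
    have := h 1
    have := h a
    have := zero_ne_one (α := F)
    grind
  exact (isFrame_veronese F).exists_orbit_map h01 (rank_eq_one_iff_mem_range_veronese h01)
end
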